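/- arXiv:1103.6159 — 3 statements merged into one kernel-verified Lean document; each statement's English description precedes it below -/
import Mathlib

section
/- Let n ∈ ℕ, μ, ν ∈ S(ℝ^n), M ∈ ℤ with M ≥ −1, and d > 0, and suppose D^α μ(0) = 0 for all multi-indices α with |α| ≤ M. Then for every N ∈ ℕ there exists a constant C_N > 0 such that for all t ∈ (0, d]: sup_{z∈ℝ^n} |((μ(t·))ˇ * ν̌)(z)| (1+|z|)^N ≤ C_N t^{M+1}, where μ(t·) denotes the function x ↦ μ(tx). -/
noncomputable section

open MeasureTheory Filter Metric Real Set SchwartzMap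
open scoped ENNReal NNReal Topology FourierTransform

/-- Euclidean space ℝⁿ. -/
abbrev Rn (n : ℕ) : Type := EuclideanSpace ℝ (Fin n)

/-- The Schwartz space 𝓢(ℝⁿ, ℂ). -/
abbrev Sch (n : ℕ) : Type := SchwartzMap (Rn n) ℂ

/-- Partial derivative in the `i`-th coordinate direction. -/
def pd {F : Type*} [NormedAddCommGroup F] [NormedSpace ℝ F] {n : ℕ} (i : Fin n)
    (g : Rn n → F) : Rn n → F :=
  fun x => lineDeriv ℝ g x (EuclideanSpace.single i (1 : ℝ))

/-- Multi-index derivative `D^α = ∂₁^{α₁} ⋯ ∂ₙ^{αₙ}`. -/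
def mderiv {F : Type*} [NormedAddCommGroup F] [NormedSpace ℝ F] {n : ℕ} (α : Fin n → ℕ)
    (g : Rn n → F) : Rn n → F :=
  (List.finRange n).foldr (fun i h => (pd i)^[α i] h) g

/-- The order `|α|` of a multi-index. -/
def mdeg {n : ℕ} (α : Fin n → ℕ) : ℕ := ∑ i, α i

/-- The Schwartz seminorm `‖φ‖_{K,L} = sup_x (1+|x|²)^{K/2} ∑_{|α| ≤ L} |D^α φ(x)|`. -/
def schSemi {n : ℕ} (K L : ℕ) (φ : Sch n) : ℝ :=
  ⨆ x : Rn n, (1 + ‖x‖ ^ 2) ^ ((K : ℝ) / 2) *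
    ∑ α : Fin n → Fin (L + 1), if mdeg (fun i => (α i : ℕ)) ≤ L
      then ‖mderiv (fun i => (α i : ℕ)) (fun y => φ y) x‖ else 0

/-- `E`-valued tempered distributions: linear maps `𝓢(ℝⁿ) → E` bounded by some
Schwartz seminorm. -/
structure TDist (n : ℕ) (E : Type*) [NormedAddCommGroup E] [NormedSpace ℂ E] where
  toFun : Sch n →ₗ[ℂ] E
  bound : ∃ (c : ℝ) (K L : ℕ), ∀ φ : Sch n, ‖toFun φ‖ ≤ c * schSemi K L φ

namespace Aux

lemma hasTemperateGrowth_sub_left {n : ℕ} (x : Rn n) :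
    Function.HasTemperateGrowth (fun y : Rn n => x - y) := by
  apply Function.HasTemperateGrowth.of_fderiv (k := 1) (C := ‖x‖ + 1)
  · have h : (fderiv ℝ (fun y : Rn n => x - y)) =
        fun _ : Rn n => -(ContinuousLinearMap.id ℝ (Rn n)) := by
      ext1 y
      rw [fderiv_const_sub]
      simp
    rw [h]
    exact .const _
  · exact (differentiable_const x).sub differentiable_id
  · intro y
    have h1 : ‖x - y‖ ≤ ‖x‖ + ‖y‖ := norm_sub_le x y
    have h2 : (0:ℝ) ≤ ‖y‖ := norm_nonneg y
    have h3 : (0:ℝ) ≤ ‖x‖ := norm_nonneg x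
    calc ‖x - y‖ ≤ ‖x‖ + ‖y‖ := h1
      _ ≤ (‖x‖ + 1) * (1 + ‖y‖) ^ 1 := by nlinarith

lemma antilipschitz_sub_left {n : ℕ} (x : Rn n) :
    AntilipschitzWith 1 (fun y : Rn n => x - y) := by
  refine (Isometry.antilipschitz ?_)
  intro y z
  simp only [edist_dist, dist_eq_norm, sub_sub_sub_cancel_left, norm_sub_rev]

end Aux

/-- The Schwartz function `y ↦ ψ(x - y)`. -/
def shiftReflect {n : ℕ} (ψ : Sch n) (x : Rn n) : Sch n :=
  SchwartzMap.compCLMOfAntilipschitz (𝕜 := ℝ)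
    (Aux.hasTemperateGrowth_sub_left x) (Aux.antilipschitz_sub_left x) ψ

/-- The dilated Schwartz function `ψ(t ·)` (junk value `0` when `t = 0`). -/
def dilate {n : ℕ} (ψ : Sch n) (t : ℝ) : Sch n :=
  if h : t = 0 then 0 else
    SchwartzMap.compCLM (𝕜 := ℝ) (g := fun y : Rn n => t • y)
      (by
        have := (t • ContinuousLinearMap.id ℝ (Rn n)).hasTemperateGrowth
        exact this)
      (⟨1, |t|⁻¹, fun y => by
        have ht : 0 < |t| := abs_pos.mpr h
        have : ‖t • y‖ = |t| * ‖y‖ := by rw [norm_smul]; simp [Real.norm_eq_abs]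
        rw [pow_one, this]
        rw [mul_add, mul_one]
        have : |t|⁻¹ * (|t| * ‖y‖) = ‖y‖ := by field_simp
        nlinarith [norm_nonneg y, inv_pos.mpr ht]⟩) ψ

/-- Fourier transform on Schwartz space. -/
def fourierS {n : ℕ} (φ : Sch n) : Sch n := FourierTransform.fourierCLE ℂ (Sch n) φ

/-- Inverse Fourier transform on Schwartz space. -/
def invFourierS {n : ℕ} (φ : Sch n) : Sch n := (FourierTransform.fourierCLE ℂ (Sch n)).symm φ

variable {n : ℕ} {E : Type*} [NormedAddCommGroup E] [NormedSpace ℂ E]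

/-- Convolution `(ψ * f)(x) := (2π)^{-n/2} f(ψ(x - ·))` of a Schwartz function with an
`E`-valued tempered distribution. -/
def tdConv (ψ : Sch n) (f : TDist n E) : Rn n → E :=
  fun x => ((2 * π) ^ (-(n : ℝ) / 2) : ℝ) • f.toFun (shiftReflect ψ x)

/-- The operator `f ↦ (φ f̂)ˇ = φ̌ * f`. -/
def mOp (φ : Sch n) (f : TDist n E) : Rn n → E := tdConv (invFourierS φ) f

/-- `L_p`-norm (in `[0,∞]`) of an `ℝ≥0∞`-valued function. -/
def lpNormENN {n : ℕ} (p : ℝ≥0∞) (g : Rn n → ℝ≥0∞) : ℝ≥0∞ :=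
  if p = ∞ then essSup g volume else (∫⁻ x, (g x) ^ p.toReal) ^ (1 / p.toReal)

/-- `ℓ_q`-norm (in `[0,∞]`) of a sequence, with the usual modification for `q = ∞`. -/
def lqSum (q : ℝ≥0∞) (a : ℕ → ℝ≥0∞) : ℝ≥0∞ :=
  if q = ∞ then ⨆ j, a j else (∑' j, (a j) ^ q.toReal) ^ (1 / q.toReal)

/-- A smooth dyadic resolution of unity. -/
structure SmoothResolution (n : ℕ) (φ : ℕ → Sch n) : Prop where
  supp0 : Function.support (φ 0) ⊆ {ξ : Rn n | ‖ξ‖ ≤ 2}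
  suppj : ∀ j : ℕ, 0 < j →
    Function.support (φ j) ⊆ {ξ : Rn n | 2 ^ ((j : ℝ) - 1) ≤ ‖ξ‖ ∧ ‖ξ‖ ≤ 2 ^ ((j : ℝ) + 1)}
  sum_eq : ∀ ξ : Rn n, ∑' j : ℕ, φ j ξ = 1
  deriv_bound : ∀ α : Fin n → ℕ, ∃ c : ℝ, ∀ (j : ℕ) (ξ : Rn n),
    ‖mderiv α (fun y => φ j y) ξ‖ ≤ c * 2 ^ (-(j : ℝ) * (mdeg α : ℝ))

/-- The Besov quasi-norm `‖f | B^s_{p,q}(E)‖` w.r.t. the resolution of unity `φ`. -/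
def besovNorm (s : ℝ) (p q : ℝ≥0∞) (φ : ℕ → Sch n) (f : TDist n E) : ℝ≥0∞ :=
  lqSum q fun j => (2 : ℝ≥0∞) ^ ((j : ℝ) * s) * eLpNorm (mOp (φ j) f) p volume

/-- The Triebel–Lizorkin quasi-norm `‖f | F^s_{p,q}(E)‖` w.r.t. the resolution of unity `φ`. -/
def triebelNorm (s : ℝ) (p q : ℝ≥0∞) (φ : ℕ → Sch n) (f : TDist n E) : ℝ≥0∞ :=
  lpNormENN p fun x =>
    lqSum q fun j => (2 : ℝ≥0∞) ^ ((j : ℝ) * s) * (‖mOp (φ j) f x‖₊ : ℝ≥0∞)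

namespace S9

open LineDeriv

abbrev ee {n : ℕ} (i : Fin n) : Rn n := EuclideanSpace.single i (1 : ℝ)

def DD {n : ℕ} (i : Fin n) (φ : Sch n) : Sch n := ∂_{ee i} φ

lemma pd_coe {n : ℕ} (i : Fin n) (φ : Sch n) : pd i (fun y => φ y) = fun y => DD i φ y := by
  funext x
  exact (SchwartzMap.lineDerivOp_apply (ee i) φ x).symm

lemma pd_iter {n : ℕ} (i : Fin n) (k : ℕ) (φ : Sch n) :
    (pd i)^[k] (fun y => φ y) = fun y => ((DD i)^[k] φ) y := by
  induction k with
  | zero => rfl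
  | succ k ih => rw [Function.iterate_succ_apply', ih, pd_coe, Function.iterate_succ_apply']

def LL {n : ℕ} (l : List (Fin n)) (α : Fin n → ℕ) (φ : Sch n) : Sch n :=
  l.foldr (fun i h => (DD i)^[α i] h) φ

lemma foldr_coe {n : ℕ} (l : List (Fin n)) (α : Fin n → ℕ) (φ : Sch n) :
    l.foldr (fun i h => (pd i)^[α i] h) (fun y => φ y) = fun y => LL l α φ y := by
  induction l with
  | nil => rfl
  | cons a l ih => rw [List.foldr_cons, ih, pd_iter]; rfl

lemma DD_comm {n : ℕ} (i j : Fin n) (φ : Sch n) : DD i (DD j φ) = DD j (DD i φ) := by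
  ext x
  have h := fun a b : Fin n => SchwartzMap.iteratedLineDerivOp_eq_iteratedFDeriv
    (m := ![ee a, ee b]) (f := φ) (x := x)
  have h2 : ∀ a b : Fin n, DD a (DD b φ) x = fderiv ℝ (fderiv ℝ φ) x (ee a) (ee b) := by
    intro a b
    have := h a b
    rw [iteratedFDeriv_two_apply] at this
    exact this
  rw [h2, h2]
  have hs : IsSymmSndFDerivAt ℝ φ x :=
    ((φ.smooth 2).contDiffAt).isSymmSndFDerivAt (by simp)
  exact hs _ _

lemma DD_iter_comm {n : ℕ} (i j : Fin n) (k : ℕ) (φ : Sch n) :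
    DD i ((DD j)^[k] φ) = (DD j)^[k] (DD i φ) := by
  have : Function.Commute (DD i) (DD j) := DD_comm i j
  exact this.iterate_right k φ

lemma LL_congr {n : ℕ} (l : List (Fin n)) (α β : Fin n → ℕ) (φ : Sch n)
    (h : ∀ i ∈ l, α i = β i) : LL l α φ = LL l β φ := by
  induction l with
  | nil => rfl
  | cons a l ih =>
    have h1 := ih (fun i hi => h i (List.mem_cons_of_mem _ hi))
    change (DD a)^[α a] (LL l α φ) = (DD a)^[β a] (LL l β φ)
    rw [h1, h a List.mem_cons_self]

lemma DD_LL {n : ℕ} (l : List (Fin n)) (hl : l.Nodup) (α : Fin n → ℕ) (φ : Sch n) (i : Fin n)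
    (hi : i ∈ l) : DD i (LL l α φ) = LL l (Function.update α i (α i + 1)) φ := by
  induction l with
  | nil => simp at hi
  | cons a l ih =>
    rw [List.nodup_cons] at hl
    change DD i ((DD a)^[α a] (LL l α φ)) = (DD a)^[_] (LL l _ φ)
    by_cases h : i = a
    · subst h
      rw [Function.update_self, Function.iterate_succ_apply']
      congr 2
      apply LL_congr
      intro j hj
      rw [Function.update_of_ne]
      rintro rfl
      exact hl.1 hj
    · have hil : i ∈ l := by
        rcases List.mem_cons.1 hi with h' | h'
        · exact absurd h' h
        · exact h'
      rw [DD_iter_comm, ih hl.2 hil, Function.update_of_ne (fun h' => h h'.symm)]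

lemma exists_alpha {n : ℕ} (m : ℕ) (v : Fin m → Fin n) (φ : Sch n) :
    ∃ α : Fin n → ℕ, mdeg α = m ∧
      ∂^{fun k => ee (v k)} φ = LL (List.finRange n) α φ := by
  induction m with
  | zero =>
    refine ⟨0, by simp [mdeg], ?_⟩
    rw [iteratedLineDerivOp_fin_zero]
    have : ∀ l : List (Fin n), LL l 0 φ = φ := by
      intro l
      induction l with
      | nil => rfl
      | cons a l ih => exact ih
    exact (this _).symm
  | succ m ih =>
    obtain ⟨α, h1, h2⟩ := ih (fun k => v k.succ)
    refine ⟨Function.update α (v 0) (α (v 0) + 1), ?_, ?_⟩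
    · unfold mdeg at *
      rw [Finset.sum_update_of_mem (Finset.mem_univ _)]
      rw [← Finset.add_sum_erase _ _ (Finset.mem_univ (v 0))] at h1
      rw [Finset.sdiff_singleton_eq_erase]
      omega
    · rw [iteratedLineDerivOp_succ_left]
      change DD (v 0) (∂^{fun k => ee (v k.succ)} φ) = _
      rw [h2, DD_LL _ (List.nodup_finRange n) _ _ _ (List.mem_finRange _)]

lemma iter_zero {n : ℕ} (μ : Sch n) (m : ℕ)
    (h : ∀ α : Fin n → ℕ, mdeg α = m → mderiv α (fun y => μ y) 0 = 0) :
    iteratedFDeriv ℝ m μ 0 = 0 := by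
  apply ContinuousMultilinearMap.toMultilinearMap_injective
  apply Module.Basis.ext_multilinear (fun _ => (EuclideanSpace.basisFun (Fin n) ℝ).toBasis)
  intro v
  obtain ⟨α, h1, h2⟩ := exists_alpha m v μ
  have h3 := h α h1
  unfold mderiv at h3
  rw [foldr_coe] at h3
  have h4 := SchwartzMap.iteratedLineDerivOp_eq_iteratedFDeriv
    (m := fun k => ee (v k)) (f := μ) (x := 0)
  replace h3 : LL (List.finRange n) α μ 0 = 0 := h3
  rw [h2, h3] at h4
  simpa using h4.symm

lemma taylor {n : ℕ} (μ : Sch n) (m : ℕ) (h : ∀ j < m, iteratedFDeriv ℝ j μ 0 = 0) (C : ℝ)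
    (hC : ∀ x, ‖iteratedFDeriv ℝ m μ x‖ ≤ C) (k : ℕ) :
    ∀ i, i + k = m → ∀ x, ‖iteratedFDeriv ℝ i μ x‖ ≤ C * ‖x‖ ^ k := by
  induction k with
  | zero =>
    intro i hi x
    obtain rfl : i = m := by omega
    simpa using hC x
  | succ k ih =>
    intro i hi x
    have h1 := ih (i + 1) (by omega)
    have hC0 : 0 ≤ C := (norm_nonneg _).trans (hC 0)
    have h2 := (convex_closedBall (0 : Rn n) ‖x‖).norm_image_sub_le_of_norm_fderiv_le (𝕜 := ℝ)
      (f := iteratedFDeriv ℝ i μ) (C := C * ‖x‖ ^ k) (x := 0) (y := x)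
      (fun y _ => (μ.smooth ⊤).differentiable_iteratedFDeriv (mod_cast ENat.natCast_lt_top i) y)
      (fun y hy => by
        rw [norm_fderiv_iteratedFDeriv]
        refine (h1 y).trans ?_
        have : ‖y‖ ≤ ‖x‖ := by simpa using hy
        gcongr) (by simp) (by simp)
    rw [h i (by omega), sub_zero, sub_zero] at h2
    rw [pow_succ, ← mul_assoc]
    exact h2

lemma dilate_apply {n : ℕ} (μ : Sch n) (t : ℝ) (ht : 0 < t) :
    (dilate μ t : Rn n → ℂ) = fun x => μ (t • x) := by
  unfold dilate
  rw [dif_neg ht.ne']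
  rfl

lemma dil_bound {n : ℕ} (μ : Sch n) (m : ℕ) (h : ∀ j < m, iteratedFDeriv ℝ j μ 0 = 0) (d : ℝ)
    (hd : 0 < d) (i : ℕ) : ∃ K ≥ (0 : ℝ), ∀ t ∈ Ioc (0 : ℝ) d, ∀ x,
      ‖iteratedFDeriv ℝ i (dilate μ t) x‖ ≤ K * t ^ m * (1 + ‖x‖) ^ m := by
  have key : ∀ t ∈ Ioc (0 : ℝ) d, ∀ x,
      ‖iteratedFDeriv ℝ i (dilate μ t) x‖ = t ^ i * ‖iteratedFDeriv ℝ i μ (t • x)‖ := by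
    intro t ht x
    rw [dilate_apply μ t ht.1, iteratedFDeriv_comp_const_smul t (μ.smooth i), norm_smul,
      norm_pow, Real.norm_of_nonneg ht.1.le]
  rcases le_total m i with hi | hi
  · obtain ⟨C, hC0, hC⟩ := μ.decay 0 i
    simp only [pow_zero, one_mul] at hC
    refine ⟨d ^ (i - m) * C, by positivity, fun t ht x => ?_⟩
    have ht0 := ht.1
    rw [key t ht x]
    have e : t ^ i = t ^ (i - m) * t ^ m := by rw [← pow_add]; congr 1; omega
    have h1 : t ^ (i - m) ≤ d ^ (i - m) := pow_le_pow_left₀ ht.1.le ht.2 _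
    have h2 : (1 : ℝ) ≤ (1 + ‖x‖) ^ m := one_le_pow₀ (by linarith [norm_nonneg x])
    calc t ^ i * ‖iteratedFDeriv ℝ i μ (t • x)‖ ≤ (d ^ (i - m) * t ^ m) * C := by
          rw [e]; gcongr; exact hC _
      _ = d ^ (i - m) * C * t ^ m * 1 := by ring
      _ ≤ _ := by gcongr
  · obtain ⟨C, hC0, hC⟩ := μ.decay 0 m
    simp only [pow_zero, one_mul] at hC
    refine ⟨C, hC0.le, fun t ht x => ?_⟩
    have ht0 := ht.1
    rw [key t ht x]
    have h1 := taylor μ m h C hC (m - i) i (by omega) (t • x)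
    rw [norm_smul, Real.norm_of_nonneg ht0.le] at h1
    have e : t ^ m = t ^ i * t ^ (m - i) := by rw [← pow_add]; congr 1; omega
    calc t ^ i * ‖iteratedFDeriv ℝ i μ (t • x)‖ ≤ t ^ i * (C * (t * ‖x‖) ^ (m - i)) := by gcongr
      _ = C * t ^ m * ‖x‖ ^ (m - i) := by rw [e]; ring
      _ ≤ C * t ^ m * (1 + ‖x‖) ^ (m - i) := by gcongr; linarith
      _ ≤ _ := by
        gcongr
        · linarith [norm_nonneg x]
        · omega

abbrev PP {n : ℕ} (f g : Sch n) : Sch n := SchwartzMap.pairing (ContinuousLinearMap.mul ℂ ℂ) f g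

lemma semi_bound {n : ℕ} (μ ν : Sch n) (m : ℕ) (h : ∀ j < m, iteratedFDeriv ℝ j μ 0 = 0) (d : ℝ)
    (hd : 0 < d) (k l : ℕ) : ∃ K ≥ (0 : ℝ), ∀ t ∈ Ioc (0 : ℝ) d,
      SchwartzMap.seminorm ℂ k l (PP (dilate μ t) ν) ≤ K * t ^ m := by
  choose K hK0 hK using dil_bound μ m h d hd
  have hB : ∀ i, ∃ B ≥ (0 : ℝ), ∀ x, (1 + ‖x‖) ^ (m + k) * ‖iteratedFDeriv ℝ i ν x‖ ≤ B := by
    intro i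
    refine ⟨_, ?_, fun x => SchwartzMap.one_add_le_sup_seminorm_apply (𝕜 := ℂ) (m := (m + k, i))
      le_rfl le_rfl ν x⟩
    positivity
  choose B hB0 hB using hB
  refine ⟨∑ i ∈ Finset.range (l + 1), (l.choose i : ℝ) * K i * B (l - i), ?_, ?_⟩
  · exact Finset.sum_nonneg fun i _ =>
      mul_nonneg (mul_nonneg (Nat.cast_nonneg _) (hK0 i)) (hB0 _)
  intro t ht
  have ht0 := ht.1
  apply SchwartzMap.seminorm_le_bound
  · exact mul_nonneg (Finset.sum_nonneg fun i _ =>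
      mul_nonneg (mul_nonneg (Nat.cast_nonneg _) (hK0 i)) (hB0 _)) (by positivity)
  intro x
  have h1 := norm_iteratedFDeriv_mul_le (𝕜 := ℝ) ((dilate μ t).smooth l) (ν.smooth l) x (n := l)
    le_rfl
  change ‖x‖ ^ k * ‖iteratedFDeriv ℝ l (fun y => dilate μ t y * ν y) x‖ ≤ _
  refine (mul_le_mul_of_nonneg_left h1 (by positivity)).trans ?_
  rw [Finset.mul_sum, Finset.sum_mul]
  refine Finset.sum_le_sum fun i _ => ?_
  have hk : ‖x‖ ^ k ≤ (1 + ‖x‖) ^ k := by gcongr; linarith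
  have hKi := hK0 i
  calc ‖x‖ ^ k * ((l.choose i : ℝ) * ‖iteratedFDeriv ℝ i (dilate μ t) x‖ *
        ‖iteratedFDeriv ℝ (l - i) ν x‖)
      ≤ (1 + ‖x‖) ^ k * ((l.choose i : ℝ) * (K i * t ^ m * (1 + ‖x‖) ^ m) *
        ‖iteratedFDeriv ℝ (l - i) ν x‖) := by
        gcongr
        exact hK i t ht x
    _ = (l.choose i : ℝ) * K i * ((1 + ‖x‖) ^ (m + k) * ‖iteratedFDeriv ℝ (l - i) ν x‖) * t ^ m := by
        rw [pow_add]; ring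
    _ ≤ _ := by
        gcongr
        exact hB _ x

lemma conv_eq {n : ℕ} (f g : Sch n) (z : Rn n) :
    ∫ y : Rn n, (invFourierS f) y * (invFourierS g) (z - y) = (invFourierS (PP f g)) z := by
  have h := SchwartzMap.convolution_apply (ContinuousLinearMap.mul ℂ ℂ)
    (invFourierS f) (invFourierS g) z
  have h2 : SchwartzMap.convolution (ContinuousLinearMap.mul ℂ ℂ)
    (invFourierS f) (invFourierS g) = invFourierS (PP f g) := by
    apply (FourierTransform.fourierCLE ℂ (Sch n)).injective
    simp only [invFourierS, ContinuousLinearEquiv.apply_symm_apply]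
    rw [FourierTransform.fourierCLE_apply, SchwartzMap.fourier_convolution]
    simp
  rw [h2] at h
  rw [h]
  rfl

lemma sum_ap {n : ℕ} (s : Finset (ℕ × ℕ)) (p : ℕ × ℕ → Seminorm ℂ (Sch n)) (f : Sch n) :
    (∑ i ∈ s, p i) f = ∑ i ∈ s, p i f := by
  classical
  induction s using Finset.induction_on with
  | empty => simp
  | insert a s ha ih => rw [Finset.sum_insert ha, Finset.sum_insert ha, Seminorm.add_apply, ih]

lemma inv_bound {n : ℕ} (N : ℕ) : ∃ s : Finset (ℕ × ℕ), ∃ C : ℝ, 0 ≤ C ∧ ∀ (f : Sch n) (z : Rn n),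
    ‖invFourierS f z‖ * (1 + ‖z‖) ^ N ≤
      C * ∑ p ∈ s, SchwartzMap.seminorm ℂ p.1 p.2 f := by
  let q : Seminorm ℂ (Sch n) :=
    ((Finset.Iic (N, 0)).sup (schwartzSeminormFamily ℂ (Rn n) ℂ)).comp
      ((FourierTransform.fourierCLE ℂ (Sch n)).symm : Sch n →ₗ[ℂ] Sch n)
  have hq : Continuous q := by
    have h1 : Continuous
        ((Finset.Iic (N, 0)).sup (schwartzSeminormFamily ℂ (Rn n) ℂ) : Seminorm ℂ (Sch n)) := by
      apply Seminorm.continuous_of_le _ (Seminorm.finset_sup_le_sum _ _)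
      have : ⇑(∑ i ∈ Finset.Iic (N, 0), schwartzSeminormFamily ℂ (Rn n) ℂ i) =
        fun f => ∑ i ∈ Finset.Iic (N, 0), schwartzSeminormFamily ℂ (Rn n) ℂ i f :=
        funext fun f => sum_ap _ _ f
      rw [this]
      exact continuous_finset_sum _ fun i _ =>
        (schwartz_withSeminorms ℂ (Rn n) ℂ).continuous_seminorm i
    exact h1.comp (FourierTransform.fourierCLE ℂ (Sch n)).symm.continuous
  obtain ⟨s, C, -, hC⟩ := Seminorm.bound_of_continuous (schwartz_withSeminorms ℂ (Rn n) ℂ) q hq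
  refine ⟨s, 2 ^ N * C, by positivity, fun f z => ?_⟩
  have h1 := SchwartzMap.one_add_le_sup_seminorm_apply (𝕜 := ℂ) (m := (N, 0)) (k := N) (n := 0)
    le_rfl le_rfl (invFourierS f) z
  rw [norm_iteratedFDeriv_zero] at h1
  have h2 : q f ≤ C * ∑ p ∈ s, SchwartzMap.seminorm ℂ p.1 p.2 f := by
    refine (hC f).trans ?_
    have h3 := Seminorm.finset_sup_le_sum (schwartzSeminormFamily ℂ (Rn n) ℂ) s f
    have h4 : (∑ i ∈ s, schwartzSeminormFamily ℂ (Rn n) ℂ i) f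
        = ∑ p ∈ s, SchwartzMap.seminorm ℂ p.1 p.2 f := by
      rw [sum_ap]
      rfl
    rw [h4] at h3
    exact mul_le_mul_of_nonneg_left h3 C.2
  rw [mul_comm]
  refine h1.trans ?_
  rw [mul_assoc]
  exact mul_le_mul_of_nonneg_left h2 (by positivity)

end S9

/-- for `μ` with vanishing moments up to order `M`, the convolution
`(μ(t·))ˇ * ν̌` decays like `t^{M+1}` with arbitrary polynomial weight. -/
theorem statement9 (n : ℕ) (μ ν : Sch n) (M : ℤ) (hM : -1 ≤ M) (d : ℝ) (hd : 0 < d)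
    (hmom : ∀ α : Fin n → ℕ, (mdeg α : ℤ) ≤ M → mderiv α (fun y => μ y) 0 = 0) :
    ∀ N : ℕ, ∃ C > (0 : ℝ), ∀ t ∈ Ioc (0 : ℝ) d, ∀ z : Rn n,
      ‖∫ y : Rn n, (invFourierS (dilate μ t)) y * (invFourierS ν) (z - y)‖ *
          (1 + ‖z‖) ^ N ≤ C * t ^ ((M : ℝ) + 1) := by
  intro N
  obtain ⟨m, hm⟩ : ∃ m : ℕ, (m : ℤ) = M + 1 := ⟨(M + 1).toNat, by omega⟩
  have h0 : ∀ j < m, iteratedFDeriv ℝ j μ 0 = 0 := fun j hj =>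
    S9.iter_zero μ j fun α hα => hmom α (by omega)
  obtain ⟨s, C, hC0, hC⟩ := S9.inv_bound (n := n) N
  choose K hK0 hK using fun p : ℕ × ℕ => S9.semi_bound μ ν m h0 d hd p.1 p.2
  have hS : 0 ≤ ∑ p ∈ s, K p := Finset.sum_nonneg fun p _ => hK0 p
  refine ⟨C * ∑ p ∈ s, K p + 1, by positivity, fun t ht z => ?_⟩
  have ht0 := ht.1
  have e : t ^ ((M : ℝ) + 1) = t ^ m := by
    rw [← Real.rpow_natCast]
    congr 1
    exact_mod_cast hm.symm
  rw [S9.conv_eq, e]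
  refine (hC _ z).trans ?_
  calc C * ∑ p ∈ s, SchwartzMap.seminorm ℂ p.1 p.2 (S9.PP (dilate μ t) ν)
      ≤ C * ∑ p ∈ s, K p * t ^ m := by
        gcongr with p hp
        exact hK p t ht
    _ = (C * ∑ p ∈ s, K p) * t ^ m := by rw [← Finset.sum_mul, mul_assoc]
    _ ≤ _ := by
        gcongr
        linarith

end
end

section
/- Let 0 < r ≤ 1 and let {b_j}_{j=0}^∞ be a sequence with values in (0,∞] and {d_j}_{j=0}^∞ a sequence with values in (0,∞). Suppose there exists N₀ ∈ ℕ with limsup_{j→∞} d_j/2^{jN₀} < ∞, and suppose that for every N ∈ ℕ there is a constant C_N > 0 with d_j ≤ C_N Σ_{k=j}^∞ 2^{(j−k)N} b_k d_k^{1−r} for all j ∈ ℕ₀. Then for every N ∈ ℕ one has d_j^r ≤ C_N Σ_{k=j}^∞ 2^{(j−k)Nr} b_k for all j ∈ ℕ₀, with the same constants C_N. -/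
noncomputable section

open MeasureTheory Filter Set
open scoped ENNReal NNReal Topology

theorem aux_key (r : ℝ) (hr0 : 0 < r) (hr1 : r ≤ 1)
    (b : ℕ → ℝ≥0∞) (e : ℕ → ℝ≥0∞) (w : ℕ → ℝ≥0∞) (c : ℝ≥0∞)
    (hw0 : w 0 = 1) (hwadd : ∀ i m, w (i + m) = w i * w m)
    (hwp : ∀ i, w i ≠ 0) (hwt : ∀ i, w i ≠ ∞)
    (j : ℕ) (he : e j ≠ 0)
    (h : ∀ k, e k ≤ c * ∑' i : ℕ, w i * b (k + i) * e (k + i) ^ (1 - r))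
    (hD : ⨆ i, w i * e (j + i) ≠ ∞) :
    e j ^ r ≤ c * ∑' i : ℕ, w i ^ r * b (j + i) := by
  set D := ⨆ i, w i * e (j + i) with hDdef
  have hle : ∀ i, w i * e (j + i) ≤ D := fun i => le_iSup (fun i => w i * e (j + i)) i
  have hej : e j ≤ D := by simpa [hw0] using hle 0
  have hD0 : D ≠ 0 := fun h0 => he (le_antisymm (h0 ▸ hej) (zero_le))
  have h1 : D ≤ (c * ∑' i : ℕ, w i ^ r * b (j + i)) * D ^ (1 - r) := by
    refine iSup_le fun i => ?_
    calc w i * e (j + i) ≤ w i * (c * ∑' m : ℕ, w m * b (j + i + m) * e (j + i + m) ^ (1 - r)) := by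
          gcongr; exact h _
      _ = c * ∑' m : ℕ, (fun l => w l * b (j + l) * e (j + l) ^ (1 - r)) (i + m) := by
          rw [mul_left_comm, ← ENNReal.tsum_mul_left]
          congr 2; ext m
          simp only [hwadd, ← add_assoc, mul_assoc]
      _ ≤ c * ∑' l : ℕ, w l * b (j + l) * e (j + l) ^ (1 - r) := by
          gcongr c * ?_
          exact ENNReal.tsum_comp_le_tsum_of_injective (add_right_injective i) _
      _ ≤ c * ∑' l : ℕ, w l ^ r * b (j + l) * D ^ (1 - r) := by
          gcongr c * ?_
          refine ENNReal.tsum_le_tsum fun l => ?_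
          calc w l * b (j + l) * e (j + l) ^ (1 - r)
              = w l ^ r * b (j + l) * (w l * e (j + l)) ^ (1 - r) := by
                rw [ENNReal.mul_rpow_of_nonneg _ _ (by linarith : 0 ≤ 1 - r)]
                have : w l = w l ^ r * w l ^ (1 - r) := by
                  rw [← ENNReal.rpow_add _ _ (hwp l) (hwt l)]; simp
                nth_rewrite 1 [this]
                ring
            _ ≤ _ := by
                gcongr
                exact hle l
      _ = _ := by rw [ENNReal.tsum_mul_right, mul_assoc]
  have h2 : D = D ^ r * D ^ (1 - r) := by
    rw [← ENNReal.rpow_add _ _ hD0 hD]; simp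
  have h3 : D ^ r * D ^ (1 - r) ≤ (c * ∑' i : ℕ, w i ^ r * b (j + i)) * D ^ (1 - r) := by
    rw [← h2]; exact h1
  have hp : D ^ (1 - r) ≠ 0 := by
    intro h0
    rcases ENNReal.rpow_eq_zero_iff.1 h0 with h | h
    · exact hD0 h.1
    · exact hD h.1
  have ht : D ^ (1 - r) ≠ ∞ := ENNReal.rpow_ne_top_of_nonneg (by linarith) hD
  have h4 := (ENNReal.mul_le_mul_iff_left hp ht).1 h3
  exact (ENNReal.rpow_le_rpow hej hr0.le).trans h4

theorem aux_fin (e : ℕ → ℝ≥0∞) (het : ∀ k, e k ≠ ∞) (N₀ : ℕ)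
    (hN₀ : Filter.limsup (fun j : ℕ =>
      e j / (2 : ℝ≥0∞) ^ ((j : ℝ) * (N₀ : ℝ))) Filter.atTop < ∞) (j : ℕ) :
    ⨆ i : ℕ, (2 : ℝ≥0∞) ^ (-(i : ℝ) * (N₀ : ℝ)) * e (j + i) ≠ ∞ := by
  obtain ⟨M, hM1, hM2⟩ := exists_between hN₀
  obtain ⟨n, hn⟩ := Filter.eventually_atTop.1 (Filter.eventually_lt_of_limsup_lt hM1)
  have key : ⨆ i : ℕ, (2 : ℝ≥0∞) ^ (-(i : ℝ) * (N₀ : ℝ)) * e (j + i) ≤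
      M * (2 : ℝ≥0∞) ^ ((j : ℝ) * (N₀ : ℝ)) + ∑ k ∈ Finset.range n, e k := by
    refine iSup_le fun i => ?_
    by_cases hi : n ≤ j + i
    · refine le_trans ?_ le_self_add
      have h1 := (ENNReal.div_le_iff (by simp [ENNReal.rpow_eq_zero_iff])
        (ENNReal.rpow_ne_top_of_nonneg (by positivity) (by simp))).1 (hn _ hi).le
      calc _ ≤ (2 : ℝ≥0∞) ^ (-(i : ℝ) * (N₀ : ℝ)) *
            (M * (2 : ℝ≥0∞) ^ (((j + i : ℕ) : ℝ) * (N₀ : ℝ))) := by gcongr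
        _ = _ := by
          rw [mul_left_comm, ← ENNReal.rpow_add _ _ (by simp) (by simp)]
          congr 2; push_cast; ring
    · refine le_trans ?_ le_add_self
      have h1 : (2 : ℝ≥0∞) ^ (-(i : ℝ) * (N₀ : ℝ)) ≤ 1 := by
        rw [neg_mul, ENNReal.rpow_neg, ENNReal.inv_le_one]
        simpa using ENNReal.rpow_le_rpow_of_exponent_le (x := 2) (by norm_num)
          (by positivity : (0 : ℝ) ≤ (i : ℝ) * (N₀ : ℝ))
      calc _ ≤ 1 * e (j + i) := by gcongr
        _ = e (j + i) := one_mul _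
        _ ≤ _ := Finset.single_le_sum (f := e) (fun _ _ => zero_le)
            (Finset.mem_range.2 (not_le.1 hi))
  refine ne_top_of_le_ne_top ?_ key
  refine ENNReal.add_ne_top.2 ⟨ENNReal.mul_ne_top hM2.ne
    (ENNReal.rpow_ne_top_of_nonneg (by positivity) (by simp)), ?_⟩
  exact (ENNReal.sum_lt_top.2 fun k _ => (het k).lt_top).ne

theorem aux_wadd (N i m : ℕ) : (2 : ℝ≥0∞) ^ (-((i + m : ℕ) : ℝ) * (N : ℝ)) =
    (2 : ℝ≥0∞) ^ (-(i : ℝ) * (N : ℝ)) * (2 : ℝ≥0∞) ^ (-(m : ℝ) * (N : ℝ)) := by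
  rw [← ENNReal.rpow_add _ _ (by simp) (by simp)]
  congr 1; push_cast; ring

/-- the iteration lemma for sequences (Lemma 3 of Rychkov); the
constants `C_N` in the conclusion are the same as in the hypothesis. -/
theorem statement11 (r : ℝ) (hr0 : 0 < r) (hr1 : r ≤ 1)
    (b : ℕ → ℝ≥0∞) (hb : ∀ j, 0 < b j)
    (d : ℕ → ℝ) (hd : ∀ j, 0 < d j)
    (N₀ : ℕ)
    (hN₀ : Filter.limsup (fun j : ℕ =>
      ENNReal.ofReal (d j) / (2 : ℝ≥0∞) ^ ((j : ℝ) * (N₀ : ℝ))) Filter.atTop < ∞)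
    (C : ℕ → ℝ) (hC : ∀ N, 0 < C N)
    (h : ∀ (N : ℕ) (j : ℕ), ENNReal.ofReal (d j) ≤ ENNReal.ofReal (C N) *
      ∑' i : ℕ, (2 : ℝ≥0∞) ^ (-(i : ℝ) * (N : ℝ)) * b (j + i) *
        ENNReal.ofReal (d (j + i)) ^ (1 - r)) :
    ∀ (N : ℕ) (j : ℕ), ENNReal.ofReal (d j) ^ r ≤ ENNReal.ofReal (C N) *
      ∑' i : ℕ, (2 : ℝ≥0∞) ^ (-(i : ℝ) * (N : ℝ) * r) * b (j + i) := by
  set e : ℕ → ℝ≥0∞ := fun k => ENNReal.ofReal (d k) with hedef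
  have he0 : ∀ k, e k ≠ 0 := fun k => by simp [hedef, hd k]
  have het : ∀ k, e k ≠ ∞ := fun k => by simp [hedef]
  have main : ∀ N j : ℕ, ⨆ i : ℕ, (2 : ℝ≥0∞) ^ (-(i : ℝ) * (N : ℝ)) * e (j + i) ≠ ∞ →
      e j ^ r ≤ ENNReal.ofReal (C N) *
        ∑' i : ℕ, (2 : ℝ≥0∞) ^ (-(i : ℝ) * (N : ℝ) * r) * b (j + i) := by
    intro N j hD
    have := aux_key r hr0 hr1 b e (fun i => (2 : ℝ≥0∞) ^ (-(i : ℝ) * (N : ℝ)))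
      (ENNReal.ofReal (C N)) (by simp) (aux_wadd N)
      (fun i => (ENNReal.rpow_pos (by simp) (by simp)).ne')
      (fun i => ENNReal.rpow_ne_top_of_ne_zero (by simp) (by simp)) j (he0 j) (h N) hD
    simpa only [← ENNReal.rpow_mul] using this
  have base : ∀ j : ℕ, e j ^ r ≤ ENNReal.ofReal (C N₀) *
        ∑' i : ℕ, (2 : ℝ≥0∞) ^ (-(i : ℝ) * (N₀ : ℝ) * r) * b (j + i) :=
    fun j => main N₀ j (aux_fin e het N₀ hN₀ j)
  intro N j
  by_cases hS : ∑' i : ℕ, (2 : ℝ≥0∞) ^ (-(i : ℝ) * (N : ℝ) * r) * b (j + i) = ∞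
  · rw [hS, ENNReal.mul_top (by simp [hC N])]
    exact le_top
  apply main N j
  rcases le_total N₀ N with hN | hN
  · refine ne_top_of_le_ne_top (aux_fin e het N₀ hN₀ j) ?_
    refine iSup_mono fun i => ?_
    gcongr ?_ * _
    apply ENNReal.rpow_le_rpow_of_exponent_le (by norm_num)
    have : (N₀ : ℝ) ≤ N := by exact_mod_cast hN
    have hi : (0 : ℝ) ≤ i := by positivity
    nlinarith
  have hNr : (N : ℝ) ≤ N₀ := by exact_mod_cast hN
  have hK : ENNReal.ofReal (C N₀) *
      ∑' i : ℕ, (2 : ℝ≥0∞) ^ (-(i : ℝ) * (N : ℝ) * r) * b (j + i) ≠ ∞ :=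
    ENNReal.mul_ne_top (by simp) hS
  set S := ∑' i : ℕ, (2 : ℝ≥0∞) ^ (-(i : ℝ) * (N : ℝ) * r) * b (j + i) with hSdef
  refine ne_top_of_le_ne_top (b := (ENNReal.ofReal (C N₀) * S) ^ (1 / r))
    (ENNReal.rpow_ne_top_of_nonneg (by positivity) hK) ?_
  refine iSup_le fun i => ?_
  rw [one_div, ENNReal.le_rpow_inv_iff hr0, ENNReal.mul_rpow_of_nonneg _ _ hr0.le, ← ENNReal.rpow_mul]
  calc _ ≤ (2 : ℝ≥0∞) ^ (-(i : ℝ) * (N : ℝ) * r) * (ENNReal.ofReal (C N₀) *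
        ∑' m : ℕ, (2 : ℝ≥0∞) ^ (-(m : ℝ) * (N : ℝ) * r) * b (j + i + m)) := by
        gcongr
        refine (base (j + i)).trans ?_
        gcongr _ * ?_
        refine ENNReal.tsum_le_tsum fun m => ?_
        gcongr ?_ * _
        apply ENNReal.rpow_le_rpow_of_exponent_le (by norm_num)
        have hm : (0 : ℝ) ≤ m := by positivity
        apply mul_le_mul_of_nonneg_right _ hr0.le
        nlinarith
    _ = ENNReal.ofReal (C N₀) * ∑' m : ℕ,
        (fun l : ℕ => (2 : ℝ≥0∞) ^ (-(l : ℝ) * (N : ℝ) * r) * b (j + l)) (i + m) := by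
        rw [mul_left_comm, ← ENNReal.tsum_mul_left]
        congr 2; ext m
        simp only [← add_assoc, ← mul_assoc]
        rw [← ENNReal.rpow_add _ _ (by simp) (by simp)]
        congr 2; push_cast; ring
    _ ≤ _ := by
        gcongr _ * ?_
        exact ENNReal.tsum_comp_le_tsum_of_injective (add_right_injective i) _

end
end

section
/- Let n ∈ ℕ, E a complex Banach space, s ∈ ℝ, 0 < p ≤ ∞, 0 < q ≤ ∞, d > 1. Let K ∈ ℕ₀ and L ∈ ℤ with L ≥ −1 satisfy K ≥ 1 + ⌊s⌋ and L ≥ ⌊σ_p − s⌋. For each ν ∈ ℕ₀ and m ∈ ℤ^n let a_{ν,m} : ℝ^n → E be such that a_{0,m} is an E-valued 1_K-atom supported in d·Q_{0,m} and, for ν ≥ 1, a_{ν,m} is an E-valued (s,p)_{K,L}-atom associated with the cube Q_{ν,m}. Let λ = {λ_{ν,m}} satisfy λ ∈ b_{p,q} or λ ∈ f_{p,q}. Then the series Σ_{ν=0}^∞ Σ_{m∈ℤ^n} λ_{ν,m} a_{ν,m} converges unconditionally in S'(ℝ^n,E); in fact, for every test function φ ∈ S(ℝ^n), the family (λ_{ν,m}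 ∫_{ℝ^n} a_{ν,m}(x) φ(x) dx)_{ν∈ℕ₀, m∈ℤ^n} is absolutely summable in E. -/
noncomputable section

open MeasureTheory Filter Metric Real Set SchwartzMap
open scoped ENNReal NNReal Topology FourierTransform

variable {n : ℕ} {E : Type*} [NormedAddCommGroup E] [NormedSpace ℂ E]

/-- The closed cube `d·Q_{ν,m}` with centre `2^{-ν}m` and side length `d·2^{-ν}`. -/
def dQ {n : ℕ} (d : ℝ) (ν : ℕ) (m : Fin n → ℤ) : Set (Rn n) :=
  {x : Rn n | ∀ i, |x i - 2 ^ (-(ν : ℝ)) * (m i : ℝ)| ≤ d * 2 ^ (-(ν : ℝ)) / 2}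

/-- The lattice point `m ∈ ℤⁿ` as a point of `ℝⁿ`. -/
def zpt {n : ℕ} (m : Fin n → ℤ) : Rn n := WithLp.toLp 2 fun i => (m i : ℝ)

/-- `σ_p = n(1/p - 1)_+`. -/
def sigmaP (n : ℕ) (p : ℝ≥0∞) : ℝ := max ((n : ℝ) * (1 / p.toReal - 1)) 0

/-- `σ_{p,q} = n(1/min(p,q) - 1)_+`. -/
def sigmaPQ (n : ℕ) (p q : ℝ≥0∞) : ℝ := max ((n : ℝ) * (1 / (min p q).toReal - 1)) 0

/-- An `E`-valued `1_K`-atom supported in `d·Q_{0,m}`. -/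
def Is1Atom {n : ℕ} {E : Type*} [NormedAddCommGroup E] [NormedSpace ℝ E]
    (K : ℕ) (d : ℝ) (m : Fin n → ℤ) (a : Rn n → E) : Prop :=
  ContDiff ℝ K a ∧ Function.support a ⊆ dQ d 0 m ∧
    ∀ α : Fin n → ℕ, mdeg α ≤ K → ∀ x, ‖mderiv α a x‖ ≤ 1

/-- An `E`-valued `(s,p)_{K,L}`-atom associated with the cube `Q_{ν,m}` (support in
`d·Q_{ν,m}`, derivative bounds, and moment conditions up to order `L`). -/
def IsSPAtom {n : ℕ} {E : Type*} [NormedAddCommGroup E] [NormedSpace ℝ E]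
    (s : ℝ) (p : ℝ≥0∞) (K : ℕ) (L : ℤ) (d : ℝ) (ν : ℕ) (m : Fin n → ℤ)
    (a : Rn n → E) : Prop :=
  ContDiff ℝ K a ∧ Function.support a ⊆ dQ d ν m ∧
    (∀ α : Fin n → ℕ, mdeg α ≤ K → ∀ x,
      ‖mderiv α a x‖ ≤ 2 ^ (-(ν : ℝ) * (s - (n : ℝ) / p.toReal) + (mdeg α : ℝ) * (ν : ℝ))) ∧
    ∀ β : Fin n → ℕ, (mdeg β : ℤ) ≤ L →
      (∫ x : Rn n, (∏ i, (x i) ^ (β i)) • a x) = 0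

/-- The sequence space norm `‖λ|b_{p,q}‖`. -/
def bNorm {n : ℕ} (p q : ℝ≥0∞) (lam : ℕ → (Fin n → ℤ) → ℂ) : ℝ≥0∞ :=
  lqSum q fun ν =>
    if p = ∞ then ⨆ m : Fin n → ℤ, (‖lam ν m‖₊ : ℝ≥0∞)
    else (∑' m : Fin n → ℤ, (‖lam ν m‖₊ : ℝ≥0∞) ^ p.toReal) ^ (1 / p.toReal)

open Classical in
/-- The `L_p`-normalised characteristic function `χ^{(p)}_{ν,m}` of `Q_{ν,m}`. -/
def chiP {n : ℕ} (p : ℝ≥0∞) (ν : ℕ) (m : Fin n → ℤ) (x : Rn n) : ℝ≥0∞ :=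
  if x ∈ dQ 1 ν m then (2 : ℝ≥0∞) ^ ((ν : ℝ) * (n : ℝ) / p.toReal) else 0

/-- The sequence space norm `‖λ|f_{p,q}‖`. -/
def fNorm {n : ℕ} (p q : ℝ≥0∞) (lam : ℕ → (Fin n → ℤ) → ℂ) : ℝ≥0∞ :=
  lpNormENN p fun x =>
    if q = ∞ then ⨆ (ν : ℕ) (m : Fin n → ℤ), (‖lam ν m‖₊ : ℝ≥0∞) * chiP p ν m x
    else (∑' (ν : ℕ) (m : Fin n → ℤ),
      ((‖lam ν m‖₊ : ℝ≥0∞) * chiP p ν m x) ^ q.toReal) ^ (1 / q.toReal)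

/-- `f = ∑_{ν,m} λ_{ν,m} a_{ν,m}` with unconditional convergence in `S'(ℝⁿ,E)`:
for every test function the pairings sum to `f(φ)`. -/
def RepresentsAtomic {n : ℕ} {E : Type*} [NormedAddCommGroup E] [NormedSpace ℂ E]
    (f : TDist n E) (lam : ℕ → (Fin n → ℤ) → ℂ)
    (a : ℕ → (Fin n → ℤ) → Rn n → E) : Prop :=
  ∀ φ : Sch n, HasSum
    (fun νm : ℕ × (Fin n → ℤ) => lam νm.1 νm.2 • ∫ x : Rn n, φ x • a νm.1 νm.2 x)
    (f.toFun φ)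

/-- Schwartz version of `pd`. -/
def sP (i : Fin n) (φ : Sch n) : Sch n :=
  LineDeriv.lineDerivOp (EuclideanSpace.single i (1 : ℝ) : Rn n) φ

lemma sP_coe (i : Fin n) (φ : Sch n) : (⇑(sP i φ) : Rn n → ℂ) = pd i ⇑φ := by
  ext x
  exact SchwartzMap.lineDerivOp_apply _ _ _

lemma sP_comm (i j : Fin n) (φ : Sch n) : sP i (sP j φ) = sP j (sP i φ) := by
  ext x
  have h : IsSymmSndFDerivAt ℝ φ x :=
    (φ.smooth 2).contDiffAt.isSymmSndFDerivAt (by simp)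
  have key : ∀ v w : Rn n, (LineDeriv.lineDerivOp v (LineDeriv.lineDerivOp w φ) : Sch n) x
      = fderiv ℝ (fderiv ℝ φ) x v w := by
    intro v w
    rw [SchwartzMap.lineDerivOp_apply_eq_fderiv]
    have : (⇑(LineDeriv.lineDerivOp w φ : Sch n) : Rn n → ℂ) = fun y => fderiv ℝ φ y w := rfl
    rw [this, fderiv_clm_apply]
    · simp
    · exact ((φ.smooth 2).fderiv_right (m := 1) (by norm_num)).differentiable (by norm_num) x
    · exact differentiableAt_const _
  unfold sP
  rw [key, key]
  exact h.eq _ _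

/-- Schwartz version of the foldr in `mderiv`. -/
def sD (l : List (Fin n)) (α : Fin n → ℕ) (φ : Sch n) : Sch n :=
  l.foldr (fun i h => (sP i)^[α i] h) φ

lemma sP_iter_coe (i : Fin n) (k : ℕ) (φ : Sch n) :
    (⇑((sP i)^[k] φ) : Rn n → ℂ) = (pd i)^[k] ⇑φ := by
  induction k with
  | zero => rfl
  | succ k ih => rw [Function.iterate_succ_apply', Function.iterate_succ_apply', sP_coe, ih]

lemma sD_coe (α : Fin n → ℕ) (φ : Sch n) :
    mderiv α (⇑φ) = (⇑(sD (List.finRange n) α φ) : Rn n → ℂ) := by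
  unfold mderiv sD
  induction (List.finRange n) with
  | nil => rfl
  | cons j t ih => rw [List.foldr_cons, List.foldr_cons, sP_iter_coe, ih]

lemma sD_congr (l : List (Fin n)) (α β : Fin n → ℕ) (φ : Sch n) (h : ∀ i ∈ l, α i = β i) :
    sD l α φ = sD l β φ := by
  induction l with
  | nil => rfl
  | cons j t ih =>
    have h1 := ih (fun i hi => h i (List.mem_cons_of_mem _ hi))
    have h2 := h j List.mem_cons_self
    simp only [sD, List.foldr_cons] at h1 ⊢
    rw [h1, h2]

lemma sP_sD (l : List (Fin n)) (hl : l.Nodup) (i : Fin n) (hi : i ∈ l) (α : Fin n → ℕ)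
    (φ : Sch n) : sP i (sD l α φ) = sD l (α + Pi.single i 1) φ := by
  induction l with
  | nil => simp at hi
  | cons j t ih =>
    have e1 : ∀ β, sD (j :: t) β φ = (sP j)^[β j] (sD t β φ) := fun β => rfl
    rw [List.nodup_cons] at hl
    rw [e1, e1]
    by_cases hij : i = j
    · subst hij
      rw [sD_congr t (α + Pi.single i 1) α φ]
      · simp only [Pi.add_apply, Pi.single_eq_same, Function.iterate_succ_apply']
      · intro k hk
        have : k ≠ i := by rintro rfl; exact hl.1 hk
        simp [this]
    · have hit : i ∈ t := by
        rcases List.mem_cons.1 hi with h | h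
        · exact absurd h hij
        · exact h
      rw [← ih hl.2 hit]
      have hji : j ≠ i := fun h => hij h.symm
      have : (α + (Pi.single i 1 : Fin n → ℕ)) j = α j := by simp [hji]
      rw [this]
      have hc : Function.Commute (sP i : Sch n → Sch n) (sP j) := fun ψ => sP_comm i j ψ
      exact (hc.iterate_right (α j)) _

/-- Schwartz multiindex derivative. -/
def sM (α : Fin n → ℕ) (φ : Sch n) : Sch n := sD (List.finRange n) α φ

lemma sM_coe (α : Fin n → ℕ) (φ : Sch n) :
    mderiv α (⇑φ) = (⇑(sM α φ) : Rn n → ℂ) := sD_coe α φ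

lemma sP_sM (i : Fin n) (α : Fin n → ℕ) (φ : Sch n) :
    sP i (sM α φ) = sM (α + Pi.single i 1) φ :=
  sP_sD _ (List.nodup_finRange n) i (List.mem_finRange i) α φ

lemma mderiv_zero_gen {F : Type*} [NormedAddCommGroup F] [NormedSpace ℝ F] (g : Rn n → F) :
    mderiv (0 : Fin n → ℕ) g = g := by
  unfold mderiv
  induction (List.finRange n) with
  | nil => rfl
  | cons j t ih => rw [List.foldr_cons, ih]; rfl

lemma sM_zero (φ : Sch n) : sM 0 φ = φ := by
  ext x
  rw [← sM_coe, mderiv_zero_gen]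

lemma mdeg_add_single (α : Fin n → ℕ) (i : Fin n) : mdeg (α + Pi.single i 1) = mdeg α + 1 := by
  simp [mdeg, Finset.sum_add_distrib]

lemma schSemi_bdd (N l : ℕ) (φ : Sch n) : BddAbove (Set.range fun x : Rn n =>
    (1 + ‖x‖ ^ 2) ^ ((N : ℝ) / 2) *
    ∑ α : Fin n → Fin (l + 1), if mdeg (fun i => (α i : ℕ)) ≤ l
      then ‖mderiv (fun i => (α i : ℕ)) (fun y => φ y) x‖ else 0) := by
  have hb : ∀ ψ : Sch n, ∃ C : ℝ, ∀ x, (1 + ‖x‖ ^ 2) ^ ((N : ℝ) / 2) * ‖ψ x‖ ≤ C := by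
    intro ψ
    have h := fun x => SchwartzMap.one_add_le_sup_seminorm_apply (𝕜 := ℝ) (m := (N, 0))
      (k := N) (n := 0) le_rfl le_rfl ψ x
    refine ⟨_, fun x => le_trans ?_ (h x)⟩
    rw [norm_iteratedFDeriv_zero]
    gcongr
    have h0 : (0:ℝ) ≤ 1 + ‖x‖ := by positivity
    calc (1 + ‖x‖ ^ 2) ^ ((N : ℝ) / 2) ≤ ((1 + ‖x‖) ^ 2) ^ ((N : ℝ) / 2) := by
          apply Real.rpow_le_rpow (by positivity) _ (by positivity)
          nlinarith [norm_nonneg x]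
      _ = (1 + ‖x‖) ^ N := by
          rw [← Real.rpow_natCast, ← Real.rpow_mul h0, ← Real.rpow_natCast]
          congr 1
          push_cast; ring
  choose C hC using hb
  refine ⟨∑ α : Fin n → Fin (l + 1), |C (sM (fun i => (α i : ℕ)) φ)|, ?_⟩
  rintro _ ⟨x, rfl⟩
  simp only
  rw [Finset.mul_sum]
  apply Finset.sum_le_sum
  intro α _
  split_ifs
  · rw [show (fun y => φ y) = ⇑φ from rfl, sM_coe]
    exact (hC _ x).trans (le_abs_self _)
  · simp

lemma schSemi_nonneg (N l : ℕ) (φ : Sch n) : 0 ≤ schSemi N l φ := by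
  apply Real.iSup_nonneg
  intro x
  apply mul_nonneg (by positivity)
  apply Finset.sum_nonneg
  intro α _
  split_ifs <;> positivity

lemma sM_le (N l : ℕ) (φ : Sch n) (α : Fin n → ℕ) (hα : mdeg α ≤ l) (x : Rn n) :
    (1 + ‖x‖ ^ 2) ^ ((N : ℝ) / 2) * ‖sM α φ x‖ ≤ schSemi N l φ := by
  refine le_trans ?_ (le_ciSup (schSemi_bdd N l φ) x)
  gcongr
  have hi : ∀ i, α i < l + 1 := fun i => by
    have : α i ≤ mdeg α := Finset.single_le_sum (f := α) (fun _ _ => Nat.zero_le _)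
      (Finset.mem_univ i)
    omega
  have := Finset.single_le_sum (s := Finset.univ) (f := fun α : Fin n → Fin (l + 1) =>
    if mdeg (fun i => (α i : ℕ)) ≤ l
      then ‖mderiv (fun i => (α i : ℕ)) (fun y => φ y) x‖ else 0)
    (fun α _ => by split_ifs <;> positivity)
    (Finset.mem_univ (fun i => (⟨α i, hi i⟩ : Fin (l + 1))))
  refine le_trans ?_ this
  simp only [hα, if_true]
  rw [show (fun y => φ y) = ⇑φ from rfl, sM_coe]

/-- directional derivative on Schwartz space -/
def sV (v : Rn n) (φ : Sch n) : Sch n := LineDeriv.lineDerivOp v φ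

lemma sV_eq (v : Rn n) (φ : Sch n) : sV v φ = ∑ i, (v i) • sP i φ := by
  have hv : v = ∑ i, (v i) • (EuclideanSpace.single i (1 : ℝ) : Rn n) := by
    ext j
    simp [Finset.sum_apply, Pi.single_apply]
  unfold sV sP
  conv_lhs => rw [hv]
  rw [LineDeriv.lineDerivOp_left_sum]
  simp only [LineDeriv.lineDerivOp_left_smul]

lemma sV_iter_sum (v : Rn n) (k : ℕ) (r : Fin n → ℝ) (ψ : Fin n → Sch n) :
    (sV v)^[k] (∑ i, r i • ψ i) = ∑ i, r i • (sV v)^[k] (ψ i) := by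
  induction k with
  | zero => rfl
  | succ k ih =>
    simp only [Function.iterate_succ_apply', ih]
    unfold sV
    rw [LineDeriv.lineDerivOp_sum]
    simp only [LineDeriv.lineDerivOp_smul]

lemma sV_iter_succ (v : Rn n) (k : ℕ) (φ : Sch n) (y : Rn n) :
    (sV v)^[k+1] φ y = ∑ i, (v i : ℂ) * (sV v)^[k] (sP i φ) y := by
  rw [Function.iterate_succ_apply, sV_eq, sV_iter_sum]
  rw [_root_.sum_apply]
  simp

lemma sV_iter_bound (v : Rn n) (l : ℕ) (φ : Sch n) (y : Rn n) (M : ℝ)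
    (hM : ∀ α, mdeg α ≤ l → ‖sM α φ y‖ ≤ M) (k : ℕ) :
    ∀ α, mdeg α + k ≤ l → ‖(sV v)^[k] (sM α φ) y‖ ≤ (∑ i, |v i|) ^ k * M := by
  induction k with
  | zero => intro α h; simpa using hM α h
  | succ k ih =>
    intro α h
    rw [sV_iter_succ, pow_succ', mul_assoc, Finset.sum_mul]
    refine (norm_sum_le _ _).trans (Finset.sum_le_sum fun i _ => ?_)
    rw [norm_mul, sP_sM]
    have := ih (α + Pi.single i 1) (by rw [mdeg_add_single]; omega)
    simp only [Complex.norm_real, Real.norm_eq_abs]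
    gcongr

lemma sV_poly (c : Rn n) (k : ℕ) : ∀ φ : Sch n, ∃ T : MvPolynomial (Fin n) ℂ,
    T.totalDegree ≤ k ∧
    ∀ x : Rn n, MvPolynomial.eval (fun i => (x i : ℂ)) T = (sV (x - c))^[k] φ c := by
  induction k with
  | zero =>
    intro φ
    exact ⟨MvPolynomial.C (φ c), by simp, by simp⟩
  | succ k ih =>
    intro φ
    choose T hT1 hT2 using fun i => ih (sP i φ)
    refine ⟨∑ i, (MvPolynomial.X i - MvPolynomial.C (c i : ℂ)) * T i, ?_, ?_⟩
    · apply MvPolynomial.totalDegree_finsetSum_le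
      intro i _
      refine (MvPolynomial.totalDegree_mul _ _).trans ?_
      have h1 : (MvPolynomial.X i - MvPolynomial.C (c i : ℂ)
          : MvPolynomial (Fin n) ℂ).totalDegree ≤ 1 :=
        (MvPolynomial.totalDegree_sub_C_le _ _).trans (by simp)
      have := hT1 i
      omega
    · intro x
      rw [sV_iter_succ, map_sum]
      apply Finset.sum_congr rfl
      intro i _
      rw [map_mul, hT2]
      simp

lemma taylor_abs (l : ℕ) : ∀ (g : ℕ → ℝ → ℂ) (M : ℝ)
    (_ : ∀ k τ, HasDerivAt (g k) (g (k+1) τ) τ)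
    (_ : ∀ τ ∈ Icc (0:ℝ) 1, ‖g l τ‖ ≤ M), ∀ t ∈ Icc (0:ℝ) 1,
    ‖g 0 t - ∑ k ∈ Finset.range l, ((t ^ k / (k.factorial : ℝ) : ℝ) : ℂ) * g k 0‖ ≤ M := by
  induction l with
  | zero => intro g M _ h t ht; simpa using h t ht
  | succ l ih =>
    intro g M hg hM t ht
    have hM0 : 0 ≤ M := (norm_nonneg _).trans (hM 0 (by simp))
    have h1 := ih (fun k => g (k+1)) M (fun k τ => hg (k+1) τ) hM
    set r : ℝ → ℂ := fun t => g 0 t -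
      ∑ k ∈ Finset.range (l+1), ((t ^ k / (k.factorial : ℝ) : ℝ) : ℂ) * g k 0 with hr
    have hd : ∀ τ, HasDerivAt r (g 1 τ -
        ∑ k ∈ Finset.range l, ((τ ^ k / (k.factorial : ℝ) : ℝ) : ℂ) * g (k+1) 0) τ := by
      intro τ
      have hs : HasDerivAt (fun t : ℝ =>
          ∑ k ∈ Finset.range (l+1), ((t ^ k / (k.factorial : ℝ) : ℝ) : ℂ) * g k 0)
          (∑ k ∈ Finset.range (l+1),
            (((k : ℝ) * τ ^ (k-1) / (k.factorial : ℝ) : ℝ) : ℂ) * g k 0) τ := by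
        apply HasDerivAt.fun_sum
        intro k _
        apply HasDerivAt.mul_const
        exact ((hasDerivAt_pow k τ).div_const _).ofReal_comp
      have he : (∑ k ∈ Finset.range (l+1),
            (((k : ℝ) * τ ^ (k-1) / (k.factorial : ℝ) : ℝ) : ℂ) * g k 0) =
          ∑ k ∈ Finset.range l, ((τ ^ k / (k.factorial : ℝ) : ℝ) : ℂ) * g (k+1) 0 := by
        rw [Finset.sum_range_succ']
        simp only [Nat.cast_zero, zero_mul, zero_div, Complex.ofReal_zero, add_zero]
        apply Finset.sum_congr rfl
        intro k _
        congr 2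
        rw [Nat.factorial_succ]
        have : (k.factorial : ℝ) ≠ 0 := by positivity
        push_cast
        field_simp
      rw [he] at hs
      exact (hg 0 τ).sub hs
    have hb := Convex.norm_image_sub_le_of_norm_hasDerivWithin_le (f := r) (s := Icc (0:ℝ) 1)
      (C := M) (x := 0) (y := t) (fun τ _ => (hd τ).hasDerivWithinAt) (fun τ hτ => h1 τ hτ)
      (convex_Icc 0 1) (by simp) ht
    have h0 : r 0 = 0 := by
      simp [hr, Finset.sum_range_succ']
    rw [h0, sub_zero] at hb
    refine hb.trans ?_
    have : ‖t - 0‖ ≤ 1 := by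
      rw [sub_zero, Real.norm_eq_abs, abs_of_nonneg ht.1]; exact ht.2
    nlinarith

lemma schwartz_taylor (c x : Rn n) (l : ℕ) (φ : Sch n) (M : ℝ)
    (hM : ∀ τ ∈ Icc (0:ℝ) 1, ∀ α, mdeg α ≤ l → ‖sM α φ (c + τ • (x - c))‖ ≤ M) :
    ‖φ x - ∑ k ∈ Finset.range l, ((1 / (k.factorial : ℝ) : ℝ) : ℂ) * (sV (x - c))^[k] φ c‖
      ≤ (∑ i, |x i - c i|) ^ l * M := by
  have h := taylor_abs l (fun k τ => (sV (x - c))^[k] φ (c + τ • (x - c)))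
    ((∑ i, |x i - c i|) ^ l * M) ?_ ?_ 1 (by simp)
  · simpa using h
  · intro k τ
    simp only [Function.iterate_succ_apply']
    generalize (sV (x - c))^[k] φ = ψ
    have h1 : HasFDerivAt ψ (fderiv ℝ ψ (c + τ • (x - c))) (c + τ • (x - c)) :=
      ψ.differentiableAt.hasFDerivAt
    have h2 : HasDerivAt (fun τ : ℝ => c + τ • (x - c)) (x - c) τ := by
      simpa using ((hasDerivAt_id τ).smul_const (x - c)).const_add c
    exact h1.comp_hasDerivAt τ h2
  · intro τ hτ
    have := sV_iter_bound (x - c) l φ (c + τ • (x - c)) M (hM τ hτ) l 0 (by simp [mdeg])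
    rw [sM_zero] at this
    simpa using this


/-- mesh size -/
def msh (ν : ℕ) : ℝ := 2 ^ (-(ν : ℝ))

lemma msh_pos (ν : ℕ) : 0 < msh ν := by unfold msh; positivity

lemma msh_le_one (ν : ℕ) : msh ν ≤ 1 := by
  unfold msh
  exact Real.rpow_le_one_of_one_le_of_nonpos (by norm_num) (by simp)

/-- centre of the cube -/
def ctr (ν : ℕ) (m : Fin n → ℤ) : Rn n := WithLp.toLp 2 fun i => msh ν * (m i : ℝ)

/-- weights -/
def wt (ν : ℕ) (m : Fin n → ℤ) : ℝ := ∏ i, ((1 + msh ν * |(m i : ℝ)|) ^ 2)⁻¹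

lemma wt_pos (ν : ℕ) (m : Fin n → ℤ) : 0 < wt ν m := by
  have := msh_pos ν
  unfold wt
  apply Finset.prod_pos
  intro i _
  positivity

lemma wt_le_one (ν : ℕ) (m : Fin n → ℤ) : wt ν m ≤ 1 := by
  have := msh_pos ν
  unfold wt
  apply Finset.prod_le_one
  · intro i _; positivity
  · intro i _
    apply inv_le_one_of_one_le₀
    apply one_le_pow₀
    have : 0 ≤ msh ν * |(m i : ℝ)| := by positivity
    linarith

lemma norm_le_sum_abs (x : Rn n) : ‖x‖ ≤ ∑ i, |x i| := by
  have hv : x = ∑ i, (x i) • (EuclideanSpace.single i (1 : ℝ) : Rn n) := by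
    ext j
    simp [Finset.sum_apply, Pi.single_apply]
  conv_lhs => rw [hv]
  refine (norm_sum_le _ _).trans (Finset.sum_le_sum fun i _ => ?_)
  rw [norm_smul]
  simp

lemma volume_dQ (d : ℝ) (ν : ℕ) (m : Fin n → ℤ) :
    volume (dQ d ν m) = ENNReal.ofReal (d * msh ν) ^ n := by
  have h : dQ d ν m = (@WithLp.ofLp 2 (Fin n → ℝ)) ⁻¹' (Set.pi Set.univ fun i =>
      Icc (msh ν * (m i : ℝ) - d * msh ν / 2) (msh ν * (m i : ℝ) + d * msh ν / 2)) := by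
    ext x
    simp only [dQ, Set.mem_ofPred_eq, Set.mem_preimage, Set.mem_pi, Set.mem_univ, true_implies,
      Set.mem_Icc, abs_le]
    apply forall_congr'
    intro i
    change (_ ≤ x i - msh ν * _ ∧ x i - msh ν * _ ≤ d * msh ν / 2) ↔ _
    constructor
    · rintro ⟨h1, h2⟩
      change -(d * msh ν / 2) ≤ _ at h1
      constructor <;> linarith
    · rintro ⟨h1, h2⟩
      change -(d * msh ν / 2) ≤ _ ∧ _
      constructor <;> linarith
  rw [h, (PiLp.volume_preserving_ofLp (Fin n)).measure_preimage
    (MeasurableSet.univ_pi fun i => measurableSet_Icc).nullMeasurableSet, volume_pi_pi]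
  simp only [Real.volume_Icc]
  rw [Finset.prod_congr rfl (g := fun _ => ENNReal.ofReal (d * msh ν))]
  · simp
  · intro i _; congr 1; ring

/-- open cubes -/
def oQ (ν : ℕ) (m : Fin n → ℤ) : Set (Rn n) :=
  (@WithLp.ofLp 2 (Fin n → ℝ)) ⁻¹' (Set.pi Set.univ fun i =>
      Ioo (msh ν * (m i : ℝ) - msh ν / 2) (msh ν * (m i : ℝ) + msh ν / 2))

lemma measurableSet_oQ (ν : ℕ) (m : Fin n → ℤ) : MeasurableSet (oQ ν m) :=
  (PiLp.volume_preserving_ofLp (Fin n)).measurable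
    (MeasurableSet.univ_pi fun i => measurableSet_Ioo)

lemma volume_oQ (ν : ℕ) (m : Fin n → ℤ) :
    volume (oQ ν m) = ENNReal.ofReal (msh ν) ^ n := by
  unfold oQ
  rw [(PiLp.volume_preserving_ofLp (Fin n)).measure_preimage
    (MeasurableSet.univ_pi fun i => measurableSet_Ioo).nullMeasurableSet, volume_pi_pi]
  simp only [Real.volume_Ioo]
  rw [Finset.prod_congr rfl (g := fun _ => ENNReal.ofReal (msh ν))]
  · simp
  · intro i _; congr 1; ring

lemma oQ_subset (ν : ℕ) (m : Fin n → ℤ) : oQ ν m ⊆ dQ 1 ν m := by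
  intro x hx i
  have h := hx i (Set.mem_univ i)
  change |x i - msh ν * _| ≤ 1 * msh ν / 2
  change _ < x i ∧ x i < _ at h
  rw [abs_le]
  constructor <;> linarith [h.1, h.2]

lemma oQ_disjoint (ν : ℕ) : Pairwise (Function.onFun Disjoint (fun m : Fin n → ℤ => oQ ν m)) := by
  intro m m' hmm
  rw [Function.onFun, Set.disjoint_left]
  intro x hx hx'
  apply hmm
  funext i
  have h := hx i (Set.mem_univ i)
  have h' := hx' i (Set.mem_univ i)
  change _ < x i ∧ x i < _ at h
  change _ < x i ∧ x i < _ at h'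
  have hp := msh_pos ν
  have h1 : msh ν * (m i : ℝ) < msh ν * ((m' i : ℝ) + 1) := by linarith [h.1, h'.2]
  have h2 : msh ν * (m' i : ℝ) < msh ν * ((m i : ℝ) + 1) := by linarith [h.2, h'.1]
  have h3 := lt_of_mul_lt_mul_left h1 hp.le
  have h4 := lt_of_mul_lt_mul_left h2 hp.le
  norm_cast at h3 h4
  omega

lemma dQ_l1 {d : ℝ} {ν : ℕ} {m : Fin n → ℤ} {x : Rn n} (hx : x ∈ dQ d ν m) :
    ∑ i, |x i - ctr ν m i| ≤ n * d / 2 * msh ν := by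
  have : ∀ i ∈ (Finset.univ : Finset (Fin n)), |x i - ctr ν m i| ≤ d * msh ν / 2 :=
    fun i _ => hx i
  refine (Finset.sum_le_sum this).trans (le_of_eq ?_)
  simp
  ring

lemma wt_bound (ν : ℕ) (m : Fin n → ℤ) (y : Rn n) (R : ℝ) (h : ‖y - ctr ν m‖ ≤ R) :
    1 ≤ (4 * (1 + R ^ 2)) ^ n * wt ν m * (1 + ‖y‖ ^ 2) ^ n := by
  have hR : 0 ≤ R := (norm_nonneg _).trans h
  have hc : ‖ctr ν m‖ ≤ ‖y‖ + R := by
    have := norm_sub_norm_le (ctr ν m) y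
    rw [norm_sub_rev] at this
    linarith
  have hm := msh_pos ν
  have key : ∏ i, (1 + msh ν * |(m i : ℝ)|) ^ 2 ≤ ∏ _i : Fin n,
      (4 * (1 + R ^ 2) * (1 + ‖y‖ ^ 2)) := by
    apply Finset.prod_le_prod
    · intro i _; positivity
    · intro i _
      have h1 : |msh ν * (m i : ℝ)| ≤ ‖ctr ν m‖ := PiLp.norm_apply_le (ctr ν m) i
      rw [abs_mul, abs_of_pos hm] at h1
      have h2 : 0 ≤ msh ν * |(m i : ℝ)| := by positivity
      have h3 : msh ν * |(m i : ℝ)| ≤ ‖y‖ + R := h1.trans hc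
      have hy := norm_nonneg y
      have h4 : (msh ν * |(m i : ℝ)|) ^ 2 ≤ (‖y‖ + R) ^ 2 := by gcongr
      nlinarith [sq_nonneg (msh ν * |(m i : ℝ)| - 1), sq_nonneg (‖y‖ - R), mul_nonneg (sq_nonneg R) (sq_nonneg ‖y‖)]
  rw [Finset.prod_const, Finset.card_univ, Fintype.card_fin, mul_pow] at key
  have hw : wt ν m = (∏ i, (1 + msh ν * |(m i : ℝ)|) ^ 2)⁻¹ := by
    unfold wt; rw [Finset.prod_inv_distrib]
  have hpos : 0 < ∏ i, (1 + msh ν * |(m i : ℝ)|) ^ 2 := by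
    apply Finset.prod_pos; intro i _; positivity
  rw [hw, mul_right_comm, ← div_eq_mul_inv, le_div_iff₀ hpos, one_mul]
  exact key

lemma moment_poly [CompleteSpace E] (l : ℕ) (a : Rn n → E) (ha : Continuous a)
    (hs : HasCompactSupport a)
    (hmom : ∀ β : Fin n → ℕ, mdeg β < l → (∫ x : Rn n, (∏ i, (x i) ^ (β i)) • a x) = 0)
    (T : MvPolynomial (Fin n) ℂ) (hT : T.totalDegree < l) :
    ∫ x : Rn n, (MvPolynomial.eval (fun i => (x i : ℂ)) T) • a x = 0 := by
  simp only [MvPolynomial.eval_eq', Finset.sum_smul]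
  rw [integral_finsetSum]
  · apply Finset.sum_eq_zero
    intro β hβ
    have h1 : mdeg (fun i => β i) < l := by
      have := MvPolynomial.le_totalDegree hβ
      rw [Finsupp.sum_fintype _ _ (by simp)] at this
      exact lt_of_le_of_lt this hT
    have h2 := hmom _ h1
    have h3 : ∀ x : Rn n, (MvPolynomial.coeff β T * ∏ i, (x i : ℂ) ^ (β i)) • a x
        = MvPolynomial.coeff β T • ((∏ i, (x i) ^ (β i)) • a x) := by
      intro x
      rw [mul_smul]
      congr 1
      rw [← Complex.coe_smul]
      push_cast
      rfl
    simp only [h3]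
    rw [integral_smul, h2, smul_zero]
  · intro β hβ
    apply Continuous.integrable_of_hasCompactSupport
    · fun_prop
    · exact hs.smul_left

set_option maxHeartbeats 1000000 in
lemma pairing [CompleteSpace E] (d : ℝ) (hd : 0 ≤ d) (ν : ℕ) (m : Fin n → ℤ) (l l' : ℕ) (hll : l ≤ l')
    (a : Rn n → E)
    (ha : Continuous a) (hsupp : Function.support a ⊆ dQ d ν m) (B : ℝ)
    (hB : ∀ x, ‖a x‖ ≤ B)
    (hmom : ∀ β : Fin n → ℕ, mdeg β < l → (∫ x : Rn n, (∏ i, (x i) ^ (β i)) • a x) = 0)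
    (φ : Sch n) :
    ‖∫ x : Rn n, φ x • a x‖ ≤ (n * d / 2 * msh ν) ^ l * ((4 * (1 + (n * d / 2) ^ 2)) ^ n *
      wt ν m * schSemi (2 * n) l' φ) * B * (d * msh ν) ^ n := by
  have hmp := msh_pos ν
  have hB0 : 0 ≤ B := (norm_nonneg _).trans (hB 0)
  set c : Rn n := ctr ν m with hc
  set R : ℝ := n * d / 2 with hR
  have hR0 : 0 ≤ R := by positivity
  have hl1 : ∀ x ∈ dQ d ν m, ∑ i, |x i - c i| ≤ R * msh ν := fun x hx => dQ_l1 hx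
  have hnorm : ∀ x ∈ dQ d ν m, ‖x - c‖ ≤ R := by
    intro x hx
    refine (norm_le_sum_abs _).trans ?_
    refine le_trans (hl1 x hx) ?_
    have := msh_le_one ν
    nlinarith
  have hs : HasCompactSupport a := by
    apply HasCompactSupport.intro (isCompact_closedBall c R)
    intro x hx
    by_contra h
    apply hx
    rw [mem_closedBall, dist_eq_norm]
    exact hnorm x (hsupp h)
  choose T hT1 hT2 using fun k => sV_poly c k φ
  set P : Rn n → ℂ := fun x =>
    ∑ k ∈ Finset.range l, ((1 / (k.factorial : ℝ) : ℝ) : ℂ) * (sV (x - c))^[k] φ c with hP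
  have hP' : ∀ x, P x = ∑ k ∈ Finset.range l, ((1 / (k.factorial : ℝ) : ℝ) : ℂ) *
      MvPolynomial.eval (fun i => (x i : ℂ)) (T k) := by
    intro x; simp only [hP, hT2]
  have hTc : ∀ k, Continuous fun x : Rn n => MvPolynomial.eval (fun i => (x i : ℂ)) (T k) := by
    intro k
    simp only [MvPolynomial.eval_eq']
    fun_prop
  have hPc : Continuous P := by
    rw [show P = _ from funext hP']
    fun_prop
  have hP0 : ∫ x, P x • a x = 0 := by
    simp only [hP', Finset.sum_smul, mul_smul]
    rw [integral_finsetSum]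
    · apply Finset.sum_eq_zero
      intro k hk
      rw [integral_smul, moment_poly l a ha hs hmom (T k)
        (lt_of_le_of_lt (hT1 k) (Finset.mem_range.1 hk)), smul_zero]
    · intro k _
      have hi : Integrable (fun x : Rn n =>
          (MvPolynomial.eval (fun i => (x i : ℂ)) (T k)) • a x) :=
        ((hTc k).smul ha).integrable_of_hasCompactSupport hs.smul_left
      exact hi.smul (((1 / (k.factorial : ℝ) : ℝ) : ℂ))
  have hi1 : Integrable (fun x => φ x • a x) :=
    (φ.continuous.smul ha).integrable_of_hasCompactSupport hs.smul_left
  have hi2 : Integrable (fun x => P x • a x) :=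
    (hPc.smul ha).integrable_of_hasCompactSupport hs.smul_left
  have heq : ∫ x, φ x • a x = ∫ x in dQ d ν m, (φ x - P x) • a x := by
    rw [setIntegral_eq_integral_of_forall_compl_eq_zero]
    · simp only [sub_smul]
      rw [integral_sub hi1 hi2, hP0, sub_zero]
    · intro x hx
      have : a x = 0 := by
        by_contra h; exact hx (hsupp h)
      rw [this, smul_zero]
  rw [heq]
  have hvol : volume (dQ d ν m) < ∞ := by
    rw [volume_dQ]; exact ENNReal.pow_lt_top ENNReal.ofReal_lt_top
  set M : ℝ := (4 * (1 + R ^ 2)) ^ n * wt ν m * schSemi (2 * n) l' φ with hM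
  have hM0 : 0 ≤ M := by
    have := wt_pos ν m
    have := schSemi_nonneg (2 * n) l' φ
    positivity
  have hbd : ∀ x ∈ dQ d ν m, ‖(φ x - P x) • a x‖ ≤ (R * msh ν) ^ l * M * B := by
    intro x hx
    rw [norm_smul]
    refine mul_le_mul ?_ (hB x) (norm_nonneg _) (by positivity)
    refine (schwartz_taylor c x l φ M ?_).trans ?_
    · intro τ hτ α hα
      have h1 : ‖(c + τ • (x - c)) - c‖ ≤ R := by
        rw [add_sub_cancel_left, norm_smul, Real.norm_eq_abs, abs_of_nonneg hτ.1]
        have := hnorm x hx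
        nlinarith [hτ.2, norm_nonneg (x - c)]
      generalize c + τ • (x - c) = y at h1
      have h2 := wt_bound ν m y R h1
      have h3 := sM_le (2 * n) l' φ α (hα.trans hll) y
      rw [show ((2 * n : ℕ) : ℝ) / 2 = (n : ℝ) by push_cast; ring, Real.rpow_natCast] at h3
      have hw := wt_pos ν m
      calc ‖sM α φ y‖ = 1 * ‖sM α φ y‖ := (one_mul _).symm
        _ ≤ ((4 * (1 + R ^ 2)) ^ n * wt ν m * (1 + ‖y‖ ^ 2) ^ n) * ‖sM α φ y‖ := by gcongr
        _ = (4 * (1 + R ^ 2)) ^ n * wt ν m * ((1 + ‖y‖ ^ 2) ^ n * ‖sM α φ y‖) := by ring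
        _ ≤ M := by rw [hM]; gcongr
    · gcongr
      exact hl1 x hx
  refine (norm_setIntegral_le_of_norm_le_const hvol hbd).trans (le_of_eq ?_)
  rw [Measure.real, volume_dQ, ENNReal.toReal_pow, ENNReal.toReal_ofReal (by positivity)]


lemma sum_nat_bound (h : ℝ) (h0 : 0 < h) (h1 : h ≤ 1) (N : ℕ) :
    ∑ j ∈ Finset.range N, h * ((1 + h * (j : ℝ)) ^ 2)⁻¹ ≤ 2 * (1 - 1 / (1 + h * (N : ℝ))) := by
  induction N with
  | zero => simp
  | succ N ih =>
    rw [Finset.sum_range_succ]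
    have hN : (0:ℝ) ≤ N := Nat.cast_nonneg N
    have ha : 0 < 1 + h * (N : ℝ) := by positivity
    have hb : 0 < 1 + h * ((N : ℝ) + 1) := by positivity
    have : h * ((1 + h * (N : ℝ)) ^ 2)⁻¹ ≤
        2 * (1 / (1 + h * (N : ℝ)) - 1 / (1 + h * ((N : ℝ) + 1))) := by
      rw [div_sub_div _ _ ha.ne' hb.ne', ← div_eq_mul_inv, ← mul_div_assoc,
        div_le_div_iff₀ (by positivity) (by positivity)]
      have h2 : 1 + h * ((N : ℝ) + 1) ≤ 2 * (1 + h * (N : ℝ)) := by nlinarith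
      have e : 2 * (1 * (1 + h * ((N : ℝ) + 1)) - (1 + h * (N : ℝ)) * 1) * (1 + h * (N : ℝ)) ^ 2
        = (h * (1 + h * (N : ℝ))) * (2 * (1 + h * (N : ℝ))) := by ring
      have e2 : h * ((1 + h * (N : ℝ)) * (1 + h * ((N : ℝ) + 1))) =
        (h * (1 + h * (N : ℝ))) * (1 + h * ((N : ℝ) + 1)) := by ring
      rw [e, e2]
      gcongr
    push_cast
    linarith

lemma sum_int_bound (h : ℝ) (h0 : 0 < h) (h1 : h ≤ 1) (S : Finset ℤ) :
    ∑ k ∈ S, h * ((1 + h * |(k : ℝ)|) ^ 2)⁻¹ ≤ 4 := by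
  set N := S.sup Int.natAbs + 1 with hN
  set f : ℤ → ℝ := fun k => h * ((1 + h * |(k : ℝ)|) ^ 2)⁻¹ with hf
  have hf0 : ∀ k, 0 ≤ f k := fun k => by simp only [hf]; positivity
  set A : Finset ℤ := (Finset.range N).image (fun j : ℕ => (j : ℤ)) with hA
  set B : Finset ℤ := (Finset.range N).image (fun j : ℕ => -(j : ℤ)) with hB
  have hsub : S ⊆ A ∪ B := by
    intro k hk
    have hk' : k.natAbs < N := Nat.lt_succ_of_le (Finset.le_sup (f := Int.natAbs) hk)
    simp only [hA, hB, Finset.mem_union, Finset.mem_image, Finset.mem_range]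
    rcases Int.natAbs_eq k with h | h
    · left; exact ⟨_, hk', h.symm⟩
    · right; exact ⟨_, hk', h.symm⟩
  have hNb : ∑ j ∈ Finset.range N, h * ((1 + h * (j : ℝ)) ^ 2)⁻¹ ≤ 2 := by
    refine (sum_nat_bound h h0 h1 N).trans ?_
    have : 0 ≤ 1 / (1 + h * (N : ℝ)) := by positivity
    linarith
  have hAs : ∑ k ∈ A, f k ≤ 2 := by
    rw [hA, Finset.sum_image (by intro a _ b _ hab; simpa using hab)]
    refine le_trans (le_of_eq (Finset.sum_congr rfl fun j _ => ?_)) hNb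
    simp [hf]
  have hBs : ∑ k ∈ B, f k ≤ 2 := by
    rw [hB, Finset.sum_image (by intro a _ b _ hab; simpa using hab)]
    refine le_trans (le_of_eq (Finset.sum_congr rfl fun j _ => ?_)) hNb
    simp [hf]
  calc ∑ k ∈ S, f k ≤ ∑ k ∈ A ∪ B, f k :=
        Finset.sum_le_sum_of_subset_of_nonneg hsub fun k _ _ => hf0 k
    _ ≤ ∑ k ∈ A ∪ B, f k + ∑ k ∈ A ∩ B, f k := by
        have := Finset.sum_nonneg (s := A ∩ B) fun k _ => hf0 k
        linarith
    _ = ∑ k ∈ A, f k + ∑ k ∈ B, f k := Finset.sum_union_inter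
    _ ≤ 4 := by linarith

lemma wt_sum (ν : ℕ) (S : Finset (Fin n → ℤ)) : ∑ m ∈ S, msh ν ^ n * wt ν m ≤ 4 ^ n := by
  classical
  have hp := msh_pos ν
  have e : ∀ m : Fin n → ℤ, msh ν ^ n * wt ν m =
      ∏ i, (msh ν * ((1 + msh ν * |(m i : ℝ)|) ^ 2)⁻¹) := by
    intro m
    rw [Finset.prod_mul_distrib]
    simp [wt]
  simp only [e]
  calc _ ≤ ∑ m ∈ Fintype.piFinset (fun i => (S.image (fun m : Fin n → ℤ => (m i : ℤ)) : Finset ℤ)),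
        ∏ i, (msh ν * ((1 + msh ν * |(m i : ℝ)|) ^ 2)⁻¹) := by
        apply Finset.sum_le_sum_of_subset_of_nonneg
        · intro m hm
          rw [Fintype.mem_piFinset]
          intro i
          exact Finset.mem_image_of_mem _ hm
        · intro m _ _
          apply Finset.prod_nonneg
          intro i _
          positivity
    _ = ∏ i, ∑ k ∈ (S.image (fun m : Fin n → ℤ => (m i : ℤ)) : Finset ℤ), (msh ν * ((1 + msh ν * |(k : ℝ)|) ^ 2)⁻¹) := by
        rw [Finset.prod_univ_sum]
    _ ≤ ∏ _i : Fin n, (4 : ℝ) := by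
        apply Finset.prod_le_prod
        · intro i _
          apply Finset.sum_nonneg
          intro k _
          positivity
        · intro i _
          exact sum_int_bound _ hp (msh_le_one ν) _
    _ = 4 ^ n := by simp

lemma rpow_rpow_one_div (x : ℝ≥0∞) {q : ℝ} (hq : 0 < q) : (x ^ q) ^ (1 / q) = x := by
  rw [← ENNReal.rpow_mul, mul_one_div_cancel hq.ne', ENNReal.rpow_one]

lemma le_lqSum (q : ℝ≥0∞) (hq : 0 < q) (b : ℕ → ℝ≥0∞) (j : ℕ) : b j ≤ lqSum q b := by
  unfold lqSum
  split_ifs with h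
  · exact le_iSup b j
  · have hq' : 0 < q.toReal := ENNReal.toReal_pos hq.ne' h
    calc b j = ((b j) ^ q.toReal) ^ (1 / q.toReal) := (rpow_rpow_one_div _ hq').symm
      _ ≤ _ := ENNReal.rpow_le_rpow (ENNReal.le_tsum (f := fun j => b j ^ q.toReal) j)
          (by positivity)

lemma le_fInner (p q : ℝ≥0∞) (hq : 0 < q) (lam : ℕ → (Fin n → ℤ) → ℂ) (ν : ℕ)
    (m : Fin n → ℤ) (x : Rn n) : (‖lam ν m‖₊ : ℝ≥0∞) * chiP p ν m x ≤
    (if q = ∞ then ⨆ (ν : ℕ) (m : Fin n → ℤ), (‖lam ν m‖₊ : ℝ≥0∞) * chiP p ν m x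
    else (∑' (ν : ℕ) (m : Fin n → ℤ),
      ((‖lam ν m‖₊ : ℝ≥0∞) * chiP p ν m x) ^ q.toReal) ^ (1 / q.toReal)) := by
  split_ifs with h
  · exact le_iSup₂ (f := fun ν m => (‖lam ν m‖₊ : ℝ≥0∞) * chiP p ν m x) ν m
  · have hq' : 0 < q.toReal := ENNReal.toReal_pos hq.ne' h
    rw [← rpow_rpow_one_div ((‖lam ν m‖₊ : ℝ≥0∞) * chiP p ν m x) hq']
    refine ENNReal.rpow_le_rpow ?_ (by positivity)
    refine le_trans ?_ (ENNReal.le_tsum ν)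
    exact ENNReal.le_tsum (f := fun m => ((‖lam ν m‖₊ : ℝ≥0∞) * chiP p ν m x) ^ q.toReal) m

lemma ofReal_msh (ν : ℕ) : ENNReal.ofReal (msh ν) = (2 : ℝ≥0∞) ^ (-(ν : ℝ)) := by
  unfold msh
  rw [← ENNReal.ofReal_rpow_of_pos (by norm_num)]
  simp

lemma lam_ctrl_top (q : ℝ≥0∞) (hq : 0 < q) (lam : ℕ → (Fin n → ℤ) → ℂ)
    (hlam : bNorm ∞ q lam < ∞ ∨ fNorm ∞ q lam < ∞) :
    ∃ B : ℝ, 0 ≤ B ∧ ∀ ν m, ‖lam ν m‖ ≤ B := by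
  suffices h : ∃ B : ℝ≥0∞, B < ∞ ∧ ∀ ν m, (‖lam ν m‖₊ : ℝ≥0∞) ≤ B by
    obtain ⟨B, hB, h⟩ := h
    refine ⟨B.toReal, ENNReal.toReal_nonneg, fun ν m => ?_⟩
    have := ENNReal.toReal_mono hB.ne (h ν m)
    simpa using this
  rcases hlam with h | h
  · refine ⟨_, h, fun ν m => ?_⟩
    refine le_trans ?_ (le_lqSum q hq _ ν)
    simp only [if_true]
    exact le_iSup (fun m => (‖lam ν m‖₊ : ℝ≥0∞)) m
  · refine ⟨_, h, fun ν m => ?_⟩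
    unfold fNorm lpNormENN
    rw [if_pos rfl]
    set g : Rn n → ℝ≥0∞ := fun x =>
      if q = ∞ then ⨆ (ν : ℕ) (m : Fin n → ℤ), (‖lam ν m‖₊ : ℝ≥0∞) * chiP ∞ ν m x
      else (∑' (ν : ℕ) (m : Fin n → ℤ),
      ((‖lam ν m‖₊ : ℝ≥0∞) * chiP ∞ ν m x) ^ q.toReal) ^ (1 / q.toReal) with hg
    have hae : ∀ᵐ x : Rn n, g x ≤ essSup g volume := ENNReal.ae_le_essSup g
    have hpos : volume (oQ ν m) ≠ 0 := by
      rw [volume_oQ]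
      apply pow_ne_zero
      simpa using msh_pos ν
    obtain ⟨x, hx, hgx⟩ : ∃ x ∈ oQ ν m, g x ≤ essSup g volume := by
      by_contra hcon
      push Not at hcon
      apply hpos
      refine measure_mono_null ?_ hae
      intro x hx hle
      exact absurd hle (not_le.2 (hcon x hx))
    have h1 := le_fInner ∞ q hq lam ν m x
    have h2 : chiP ∞ ν m x = 1 := by
      unfold chiP
      rw [if_pos (oQ_subset ν m hx)]
      simp
    rw [h2, mul_one] at h1
    exact h1.trans hgx

lemma lam_ctrl (p q : ℝ≥0∞) (hp : 0 < p) (hp' : p ≠ ∞) (hq : 0 < q)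
    (lam : ℕ → (Fin n → ℤ) → ℂ)
    (hlam : bNorm p q lam < ∞ ∨ fNorm p q lam < ∞) :
    ∃ B : ℝ, 0 ≤ B ∧ ∀ ν (S : Finset (Fin n → ℤ)), ∑ m ∈ S, ‖lam ν m‖ ^ p.toReal ≤ B := by
  have hP : 0 < p.toReal := ENNReal.toReal_pos hp.ne' hp'
  suffices h : ∃ B : ℝ≥0∞, B < ∞ ∧ ∀ ν, ∑' m, (‖lam ν m‖₊ : ℝ≥0∞) ^ p.toReal ≤ B by
    obtain ⟨B, hB, h⟩ := h
    refine ⟨B.toReal, ENNReal.toReal_nonneg, fun ν S => ?_⟩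
    have := ENNReal.toReal_mono hB.ne ((ENNReal.sum_le_tsum S).trans (h ν))
    rw [ENNReal.toReal_sum] at this
    · refine le_trans (le_of_eq (Finset.sum_congr rfl fun m _ => ?_)) this
      rw [← ENNReal.toReal_rpow]
      simp
    · intro m _
      exact ENNReal.rpow_ne_top_of_nonneg hP.le ENNReal.coe_ne_top
  rcases hlam with h | h
  · refine ⟨(bNorm p q lam) ^ p.toReal, ENNReal.rpow_lt_top_of_nonneg hP.le h.ne, fun ν => ?_⟩
    have := le_lqSum q hq (fun ν =>
      if p = ∞ then ⨆ m : Fin n → ℤ, (‖lam ν m‖₊ : ℝ≥0∞)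
      else (∑' m : Fin n → ℤ, (‖lam ν m‖₊ : ℝ≥0∞) ^ p.toReal) ^ (1 / p.toReal)) ν
    simp only [if_neg hp'] at this
    have h2 := ENNReal.rpow_le_rpow this hP.le
    rw [← ENNReal.rpow_mul, one_div_mul_cancel hP.ne', ENNReal.rpow_one] at h2
    refine h2.trans (le_of_eq ?_)
    unfold bNorm
    simp only [if_neg hp']
  · refine ⟨(fNorm p q lam) ^ p.toReal, ENNReal.rpow_lt_top_of_nonneg hP.le h.ne, fun ν => ?_⟩
    unfold fNorm lpNormENN
    rw [if_neg hp', ← ENNReal.rpow_mul, one_div_mul_cancel hP.ne', ENNReal.rpow_one]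
    refine le_trans ?_ (setLIntegral_le_lintegral (⋃ m : Fin n → ℤ, oQ ν m) _)
    rw [lintegral_iUnion (fun m => measurableSet_oQ ν m) (oQ_disjoint ν)]
    apply ENNReal.tsum_le_tsum
    intro m
    calc (‖lam ν m‖₊ : ℝ≥0∞) ^ p.toReal
        = ∫⁻ x in oQ ν m, (((‖lam ν m‖₊ : ℝ≥0∞) *
          (2 : ℝ≥0∞) ^ ((ν : ℝ) * (n : ℝ) / p.toReal))) ^ p.toReal := by
          rw [setLIntegral_const, volume_oQ, ofReal_msh, ENNReal.mul_rpow_of_nonneg _ _ hP.le,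
            ← ENNReal.rpow_mul, div_mul_cancel₀ _ hP.ne', ← ENNReal.rpow_natCast,
            ← ENNReal.rpow_mul, mul_assoc, ← ENNReal.rpow_add _ _ (by norm_num) (by norm_num)]
          simp
      _ ≤ _ := by
          apply setLIntegral_mono' (measurableSet_oQ ν m)
          intro x hx
          apply ENNReal.rpow_le_rpow _ hP.le
          refine le_trans ?_ (le_fInner p q hq lam ν m x)
          unfold chiP
          rw [if_pos (oQ_subset ν m hx)]

lemma lam_sum (p q : ℝ≥0∞) (hp : 0 < p) (hq : 0 < q) (lam : ℕ → (Fin n → ℤ) → ℂ)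
    (hlam : bNorm p q lam < ∞ ∨ fNorm p q lam < ∞) :
    ∃ C : ℝ, 0 ≤ C ∧ ∀ ν (S : Finset (Fin n → ℤ)),
      ∑ m ∈ S, ‖lam ν m‖ * msh ν ^ ((n : ℝ) - n / p.toReal + sigmaP n p) * wt ν m ≤ C := by
  by_cases hpt : p = ∞
  · subst hpt
    obtain ⟨B, hB0, hB⟩ := lam_ctrl_top q hq lam hlam
    refine ⟨B * 4 ^ n, by positivity, fun ν S => ?_⟩
    have he : ((n : ℝ) - n / (∞ : ℝ≥0∞).toReal + sigmaP n ∞) = (n : ℝ) := by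
      simp [sigmaP]
    rw [he]
    simp only [Real.rpow_natCast]
    calc _ ≤ ∑ m ∈ S, B * (msh ν ^ n * wt ν m) := by
          apply Finset.sum_le_sum
          intro m _
          have := msh_pos ν
          have := wt_pos ν m
          rw [mul_assoc]
          gcongr
          exact hB ν m
      _ ≤ _ := by
          rw [← Finset.mul_sum]
          gcongr
          exact wt_sum ν S
  obtain ⟨B, hB0, hB⟩ := lam_ctrl p q hp hpt hq lam hlam
  have hP : 0 < p.toReal := ENNReal.toReal_pos hp.ne' hpt
  set P := p.toReal with hPdef
  by_cases hP1 : 1 ≤ P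
  · refine ⟨B + 4 ^ n, by positivity, fun ν S => ?_⟩
    have hs : sigmaP n p = 0 := by
      unfold sigmaP
      apply max_eq_right
      rw [← hPdef]
      have : 1 / P ≤ 1 := by rw [div_le_one hP]; exact hP1
      have hn : (0:ℝ) ≤ n := Nat.cast_nonneg n
      nlinarith
    have hle : ∀ m ∈ S, ‖lam ν m‖ * msh ν ^ ((n : ℝ) - n / P + sigmaP n p) * wt ν m ≤
        ‖lam ν m‖ ^ P + msh ν ^ n * wt ν m := by
      intro m _
      have hm := msh_pos ν
      have hw := wt_pos ν m
      have hw1 := wt_le_one ν m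
      set A := ‖lam ν m‖ with hA
      have hA0 : 0 ≤ A := norm_nonneg _
      set u : ℝ := msh ν ^ n * wt ν m with hu
      have hu0 : 0 < u := by positivity
      have hexp : 0 ≤ 1 - 1 / P := by
        have : 1 / P ≤ 1 := by rw [div_le_one hP]; exact hP1
        linarith
      have h1 : msh ν ^ ((n : ℝ) - n / P + sigmaP n p) * wt ν m ≤ u ^ (1 - 1 / P) := by
        rw [hu, Real.mul_rpow (by positivity) hw.le, ← Real.rpow_natCast, ← Real.rpow_mul hm.le,
          hs]
        have e : (n : ℝ) - n / P + 0 = n * (1 - 1 / P) := by ring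
        rw [e]
        gcongr
        calc wt ν m = wt ν m ^ (1:ℝ) := (Real.rpow_one _).symm
          _ ≤ wt ν m ^ (1 - 1 / P) := by
            apply Real.rpow_le_rpow_of_exponent_ge hw hw1
            have : 0 < 1 / P := by positivity
            linarith
      set M := max A (u ^ (1 / P)) with hM
      have hM0 : 0 < M := lt_of_lt_of_le (by positivity) (le_max_right _ _)
      have h2 : u ^ (1 - 1 / P) ≤ M ^ (P - 1) := by
        have : u ^ (1 - 1 / P) = (u ^ (1 / P)) ^ (P - 1) := by
          rw [← Real.rpow_mul hu0.le]
          congr 1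
          field_simp
        rw [this]
        exact Real.rpow_le_rpow (by positivity) (le_max_right _ _) (by linarith)
      have h3 : M ^ P ≤ A ^ P + u := by
        rcases max_choice A (u ^ (1 / P)) with h | h
        · rw [hM, h]; linarith
        · rw [hM, h, ← Real.rpow_mul hu0.le, one_div_mul_cancel hP.ne', Real.rpow_one]
          have : 0 ≤ A ^ P := by positivity
          linarith
      calc A * msh ν ^ ((n : ℝ) - n / P + sigmaP n p) * wt ν m
          = A * (msh ν ^ ((n : ℝ) - n / P + sigmaP n p) * wt ν m) := by ring
        _ ≤ M * M ^ (P - 1) := by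
            apply mul_le_mul (le_max_left _ _) (h1.trans h2) (by positivity) hM0.le
        _ = M ^ P := by
            rw [← Real.rpow_one_add' hM0.le (by linarith)]
            congr 1; ring
        _ ≤ _ := h3
    refine (Finset.sum_le_sum hle).trans ?_
    rw [Finset.sum_add_distrib]
    exact add_le_add (hB ν S) (wt_sum ν S)
  · push Not at hP1
    refine ⟨B * (B ^ (1 / P)) ^ (1 - P), by positivity, fun ν S => ?_⟩
    have hs : (n : ℝ) - n / P + sigmaP n p = 0 := by
      unfold sigmaP
      rw [max_eq_left]
      · rw [← hPdef]; ring
      · rw [← hPdef]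
        have : 1 ≤ 1 / P := by rw [le_div_iff₀ hP]; linarith
        have hn : (0:ℝ) ≤ n := Nat.cast_nonneg n
        nlinarith
    rw [hs]
    have hle : ∀ m ∈ S, ‖lam ν m‖ * msh ν ^ (0 : ℝ) * wt ν m ≤
        ‖lam ν m‖ ^ P * (B ^ (1 / P)) ^ (1 - P) := by
      intro m _
      rw [Real.rpow_zero, mul_one]
      have hw1 := wt_le_one ν m
      have h1 : ‖lam ν m‖ ^ P ≤ B := by simpa using hB ν {m}
      have h2 : ‖lam ν m‖ ≤ B ^ (1 / P) := by
        have := Real.rpow_le_rpow (by positivity) h1 (z := 1 / P) (by positivity)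
        rwa [← Real.rpow_mul (norm_nonneg _), mul_one_div_cancel hP.ne', Real.rpow_one] at this
      calc ‖lam ν m‖ * wt ν m ≤ ‖lam ν m‖ * 1 := by gcongr
        _ = ‖lam ν m‖ ^ P * ‖lam ν m‖ ^ (1 - P) := by
            rw [← Real.rpow_add_of_nonneg (norm_nonneg _) hP.le (by linarith)]
            simp
        _ ≤ _ := by
            gcongr
    refine (Finset.sum_le_sum hle).trans ?_
    rw [← Finset.sum_mul]
    gcongr
    exact hB ν S


lemma summable_core (C ε : ℝ) (hC : 0 ≤ C) (hε : 0 < ε) (F : ℕ → (Fin n → ℤ) → ℝ)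
    (hF0 : ∀ ν m, 0 ≤ F ν m) (hF : ∀ ν (S : Finset (Fin n → ℤ)), ∑ m ∈ S, F ν m ≤ C) :
    Summable fun νm : ℕ × (Fin n → ℤ) => msh νm.1 ^ ε * F νm.1 νm.2 := by
  have hm : ∀ ν, 0 ≤ msh ν ^ ε := fun ν => Real.rpow_nonneg (msh_pos ν).le _
  have hs : ∀ ν, Summable (F ν) := fun ν => summable_of_sum_le (hF0 ν) (hF ν)
  rw [summable_prod_of_nonneg (fun νm => mul_nonneg (hm _) (hF0 _ _))]
  constructor
  · intro ν
    exact (hs ν).mul_left (msh ν ^ ε)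
  · simp only [tsum_mul_left]
    have hg : Summable fun ν : ℕ => msh ν ^ ε * C := by
      apply Summable.mul_right
      have : ∀ ν : ℕ, msh ν ^ ε = ((2:ℝ) ^ (-ε)) ^ ν := by
        intro ν
        unfold msh
        rw [← Real.rpow_mul (by norm_num), ← Real.rpow_natCast, ← Real.rpow_mul (by norm_num)]
        congr 1; ring
      simp only [this]
      apply summable_geometric_of_lt_one (by positivity)
      exact Real.rpow_lt_one_of_one_lt_of_neg (by norm_num) (by linarith)
    refine Summable.of_nonneg_of_le (fun ν => mul_nonneg (hm ν) (tsum_nonneg (hF0 ν)))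
      (fun ν => ?_) hg
    exact mul_le_mul_of_nonneg_left ((hs ν).tsum_le_of_sum_le (hF ν)) (hm ν)

lemma atom_bound [CompleteSpace E] (s : ℝ) (p : ℝ≥0∞)
    (d : ℝ) (hd : 1 < d) (K : ℕ) (L : ℤ) (l : ℕ) (hl : (l : ℤ) = L + 1)
    (a : ℕ → (Fin n → ℤ) → Rn n → E)
    (ha0 : ∀ m, Is1Atom K d m (a 0 m))
    (ha : ∀ ν m, 0 < ν → IsSPAtom s p K L d ν m (a ν m)) :
    ∃ C : ℝ, 0 ≤ C ∧ ∀ ν m (φ : Sch n), ‖∫ x : Rn n, φ x • a ν m x‖ ≤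
      C * schSemi (2 * n) l φ * (msh ν ^ ((l : ℝ) + n + s - n / p.toReal) * wt ν m) := by
  have hd0 : 0 ≤ d := by linarith
  set R : ℝ := n * d / 2 with hR
  have hR0 : 0 ≤ R := by positivity
  set D : ℝ := (4 * (1 + R ^ 2)) ^ n * d ^ n with hD
  refine ⟨(1 + R ^ l) * D, by positivity, fun ν m φ => ?_⟩
  have hφ := schSemi_nonneg (2 * n) l φ
  have hw := wt_pos ν m
  rcases Nat.eq_zero_or_pos ν with rfl | hν
  · obtain ⟨h1, h2, h3⟩ := ha0 m
    have hm1 : msh 0 = 1 := by simp [msh]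
    have := pairing d hd0 0 m 0 l (Nat.zero_le _) (a 0 m) h1.continuous h2 1
      (fun x => by simpa [mderiv_zero_gen] using h3 0 (by simp [mdeg]) x)
      (fun β hβ => absurd hβ (Nat.not_lt_zero _)) φ
    rw [hm1] at this ⊢
    rw [Real.one_rpow]
    refine this.trans ?_
    rw [← hR]
    have e : (R * 1) ^ 0 * ((4 * (1 + R ^ 2)) ^ n * wt 0 m * schSemi (2 * n) l φ) * 1 *
      (d * 1) ^ n = 1 * D * schSemi (2 * n) l φ * (1 * wt 0 m) := by
      rw [hD]; simp only [mul_one, pow_zero, one_mul]; ring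
    rw [e]
    gcongr
    have : 0 ≤ R ^ l := by positivity
    linarith
  · obtain ⟨h1, h2, h3, h4⟩ := ha ν m hν
    have hm := msh_pos ν
    have hB : ∀ x, ‖a ν m x‖ ≤ msh ν ^ (s - (n : ℝ) / p.toReal) := by
      intro x
      have := h3 0 (by simp [mdeg]) x
      rw [mderiv_zero_gen] at this
      refine this.trans (le_of_eq ?_)
      unfold msh
      rw [← Real.rpow_mul (by norm_num)]
      simp [mdeg]
    have := pairing d hd0 ν m l l le_rfl (a ν m) h1.continuous h2 _ hB
      (fun β hβ => h4 β (by omega)) φ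
    refine this.trans ?_
    rw [← hR]
    have e0 : msh ν ^ ((l : ℝ) + n + s - n / p.toReal) =
        msh ν ^ l * msh ν ^ n * msh ν ^ (s - (n : ℝ) / p.toReal) := by
      rw [← Real.rpow_natCast, ← Real.rpow_natCast, ← Real.rpow_add hm, ← Real.rpow_add hm]
      congr 1; ring
    have e : (R * msh ν) ^ l * ((4 * (1 + R ^ 2)) ^ n * wt ν m * schSemi (2 * n) l φ) *
      msh ν ^ (s - (n : ℝ) / p.toReal) * (d * msh ν) ^ n = R ^ l * D * schSemi (2 * n) l φ *
      (msh ν ^ ((l : ℝ) + n + s - n / p.toReal) * wt ν m) := by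
      rw [hD, e0]; simp only [mul_pow]; ring
    rw [e]
    gcongr
    linarith


/-- atomic series converge unconditionally in `S'(ℝⁿ,E)`, and the
pairings with any test function are absolutely summable. -/
theorem statement12 (n : ℕ) (E : Type*) [NormedAddCommGroup E] [NormedSpace ℂ E]
    [CompleteSpace E] (s : ℝ) (p q : ℝ≥0∞) (hp : 0 < p) (hq : 0 < q)
    (d : ℝ) (hd : 1 < d) (K : ℕ) (L : ℤ) (hL : -1 ≤ L)
    (hK : 1 + ⌊s⌋ ≤ (K : ℤ)) (hLs : ⌊sigmaP n p - s⌋ ≤ L)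
    (lam : ℕ → (Fin n → ℤ) → ℂ) (a : ℕ → (Fin n → ℤ) → Rn n → E)
    (ha0 : ∀ m, Is1Atom K d m (a 0 m))
    (ha : ∀ ν m, 0 < ν → IsSPAtom s p K L d ν m (a ν m))
    (hlam : bNorm p q lam < ∞ ∨ fNorm p q lam < ∞) :
    (∀ φ : Sch n, Summable fun νm : ℕ × (Fin n → ℤ) =>
      ‖lam νm.1 νm.2 • ∫ x : Rn n, φ x • a νm.1 νm.2 x‖) ∧
    ∃ f : TDist n E, RepresentsAtomic f lam a := by


  obtain ⟨l, hl⟩ : ∃ l : ℕ, (l : ℤ) = L + 1 := ⟨(L + 1).toNat, by omega⟩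
  obtain ⟨C, hC0, hC⟩ := atom_bound s p d hd K L l hl a ha0 ha
  obtain ⟨B, hB0, hB⟩ := lam_sum p q hp hq lam hlam
  set ε : ℝ := s + l - sigmaP n p with hεdef
  have hε : 0 < ε := by
    have h1 : sigmaP n p - s < (⌊sigmaP n p - s⌋ : ℝ) + 1 := Int.lt_floor_add_one _
    have h2 : (⌊sigmaP n p - s⌋ : ℝ) ≤ (L : ℝ) := by exact_mod_cast hLs
    have h3 : (l : ℝ) = (L : ℝ) + 1 := by exact_mod_cast hl
    rw [hεdef]
    linarith
  set F : ℕ → (Fin n → ℤ) → ℝ := fun ν m =>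
    ‖lam ν m‖ * msh ν ^ ((n : ℝ) - n / p.toReal + sigmaP n p) * wt ν m with hF
  have hF0 : ∀ ν m, 0 ≤ F ν m := by
    intro ν m
    have := msh_pos ν
    have := wt_pos ν m
    simp only [hF]
    positivity
  have hsum := summable_core B ε hB0 hε F hF0 hB
  have hle : ∀ (φ : Sch n) (νm : ℕ × (Fin n → ℤ)),
      ‖lam νm.1 νm.2 • ∫ x : Rn n, φ x • a νm.1 νm.2 x‖ ≤
      C * schSemi (2 * n) l φ * (msh νm.1 ^ ε * F νm.1 νm.2) := by
    rintro φ ⟨ν, m⟩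
    simp only
    rw [norm_smul]
    have hm := msh_pos ν
    have e : msh ν ^ ((l : ℝ) + n + s - n / p.toReal) =
        msh ν ^ ε * msh ν ^ ((n : ℝ) - n / p.toReal + sigmaP n p) := by
      rw [← Real.rpow_add hm]
      congr 1
      rw [hεdef]; ring
    have h := hC ν m φ
    rw [e] at h
    calc _ ≤ ‖lam ν m‖ * (C * schSemi (2 * n) l φ *
          (msh ν ^ ε * msh ν ^ ((n : ℝ) - n / p.toReal + sigmaP n p) * wt ν m)) := by gcongr
      _ = _ := by simp only [hF]; ring
  have hS : ∀ φ : Sch n, Summable fun νm : ℕ × (Fin n → ℤ) =>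
      ‖lam νm.1 νm.2 • ∫ x : Rn n, φ x • a νm.1 νm.2 x‖ := fun φ =>
    Summable.of_nonneg_of_le (fun _ => norm_nonneg _) (hle φ) (hsum.mul_left _)
  have hS' : ∀ φ : Sch n, Summable fun νm : ℕ × (Fin n → ℤ) =>
      lam νm.1 νm.2 • ∫ x : Rn n, φ x • a νm.1 νm.2 x := fun φ => (hS φ).of_norm
  have hint : ∀ (φ : Sch n) ν m, Integrable (fun x => φ x • a ν m x) := by
    intro φ ν m
    have hcs : Continuous (a ν m) ∧ Function.support (a ν m) ⊆ dQ d ν m := by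
      rcases Nat.eq_zero_or_pos ν with rfl | hν
      · exact ⟨(ha0 m).1.continuous, (ha0 m).2.1⟩
      · exact ⟨(ha ν m hν).1.continuous, (ha ν m hν).2.1⟩
    have hs : HasCompactSupport (a ν m) := by
      apply HasCompactSupport.intro (isCompact_closedBall (ctr ν m) (n * d / 2 * msh ν))
      intro x hx
      by_contra h
      apply hx
      rw [mem_closedBall, dist_eq_norm]
      exact (norm_le_sum_abs _).trans (dQ_l1 (hcs.2 h))
    exact (φ.continuous.smul hcs.1).integrable_of_hasCompactSupport hs.smul_left
  refine ⟨hS, ⟨{ toFun := ?_, bound := ?_ }, ?_⟩⟩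
  · exact
      { toFun := fun φ => ∑' νm : ℕ × (Fin n → ℤ),
          lam νm.1 νm.2 • ∫ x : Rn n, φ x • a νm.1 νm.2 x
        map_add' := by
          intro φ ψ
          rw [← (hS' φ).tsum_add (hS' ψ)]
          apply tsum_congr
          intro νm
          rw [← smul_add, ← integral_add (hint φ _ _) (hint ψ _ _)]
          simp only [SchwartzMap.add_apply, add_smul]
        map_smul' := by
          intro c φ
          simp only [RingHom.id_apply]
          rw [← (hS' φ).tsum_const_smul c]
          apply tsum_congr
          intro νm
          have h : ∫ x : Rn n, (c • φ) x • a νm.1 νm.2 x =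
              c • ∫ x : Rn n, φ x • a νm.1 νm.2 x := by
            rw [← integral_smul]
            simp only [SchwartzMap.smul_apply, smul_assoc]
          rw [h, smul_comm] }
  · refine ⟨C * ∑' νm : ℕ × (Fin n → ℤ), msh νm.1 ^ ε * F νm.1 νm.2, 2 * n, l, fun φ => ?_⟩
    refine (norm_tsum_le_tsum_norm (hS φ)).trans ?_
    refine ((hS φ).tsum_le_tsum (hle φ) (hsum.mul_left _)).trans (le_of_eq ?_)
    rw [tsum_mul_left]
    ring
  · intro φ
    exact (hS' φ).hasSum

end
end
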